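/- Let 𝔤 be a finite-dimensional simple Lie algebra over the field ℂ of complex numbers satisfying the condition 𝒜(n), i.e. every abelian Lie subalgebra of 𝔤 has dimension at most n. Then dim 𝔤 ≤ 7n. -/

import Mathlib

/-- A finite-type indecomposable Cartan matrix `A` with symmetrizer `d`. -/
structure FiniteCartan (I : Type*) [Fintype I] [DecidableEq I] where
  /-- the Cartan matrix -/
  A : I → I → ℤ
  /-- the symmetrizer, i.e. the squared root lengths -/
  d : I → ℤ
  A_self : ∀ i, A i i = 2
  A_nonpos : ∀ i j, i ≠ j → A i j ≤ 0
  d_pos : ∀ i, 0 < d i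
  symm : ∀ i j, A i j * d j = A j i * d i
  posDef : ∀ x : I → ℤ, x ≠ 0 → 0 < ∑ i, ∑ j, x i * x j * (A i j * d j)
  connected : ∀ (p : I → Prop) (i j : I), p i → (∀ i j, p i → A j i ≠ 0 → p j) → p j

namespace FiniteCartan

section

variable {I : Type*} [Fintype I] [DecidableEq I] (D : FiniteCartan I)

/-- The pairing of a vector with a simple coroot. -/
def pair (p : I) : (I → ℤ) →ₗ[ℤ] ℤ := ∑ i, D.A i p • LinearMap.proj i

lemma pair_apply (p : I) (x : I → ℤ) : D.pair p x = ∑ i, D.A i p * x i := by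
  simp [pair, LinearMap.sum_apply]

@[simp] lemma pair_single (p i : I) : D.pair p (Pi.single i 1) = D.A i p := by
  simp [pair_apply, Pi.single_apply]

/-- The invariant bilinear form. -/
def form : LinearMap.BilinForm ℤ (I → ℤ) :=
  ∑ p, (D.d p) • (LinearMap.mul ℤ ℤ).compl₁₂ (D.pair p) (LinearMap.proj p)

lemma form_apply (x y : I → ℤ) : D.form x y = ∑ p, D.d p * (D.pair p x * y p) := by
  simp [form, LinearMap.sum_apply]

@[simp] lemma form_single_right (x : I → ℤ) (p : I) :
    D.form x (Pi.single p 1) = D.d p * D.pair p x := by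
  simp [form_apply, Pi.single_apply]

lemma form_symm (x y : I → ℤ) : D.form x y = D.form y x := by
  simp only [form_apply, pair_apply, Finset.sum_mul, Finset.mul_sum]
  rw [Finset.sum_comm]
  refine Finset.sum_congr rfl fun i _ ↦ Finset.sum_congr rfl fun j _ ↦ ?_
  linear_combination x i * y j * D.symm i j

lemma form_pos {x : I → ℤ} (hx : x ≠ 0) : 0 < D.form x x := by
  convert D.posDef x hx using 1
  simp only [form_apply, pair_apply, Finset.sum_mul, Finset.mul_sum]
  rw [Finset.sum_comm]
  refine Finset.sum_congr rfl fun i _ ↦ Finset.sum_congr rfl fun j _ ↦ ?_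
  ring

lemma eq_zero_of_pair_eq_zero {x : I → ℤ} (hx : ∀ p, x p ≠ 0 → D.pair p x = 0) : x = 0 := by
  by_contra h
  have := D.form_pos h
  rw [form_apply, Finset.sum_eq_zero] at this
  · exact lt_irrefl _ this
  · intro p _
    by_cases hp : x p = 0
    · simp [hp]
    · simp [hx p hp]

lemma A_eq_zero_iff (i j : I) : D.A i j = 0 ↔ D.A j i = 0 := by
  have h := D.symm i j
  have h1 := D.d_pos i
  have h2 := D.d_pos j
  constructor
  · intro h0
    rw [h0, zero_mul] at h
    rcases mul_eq_zero.mp h.symm with h | h <;> omega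
  · intro h0
    rw [h0, zero_mul] at h
    rcases mul_eq_zero.mp h with h | h <;> omega

/-- The total weight of the edges joining a vector to pairwise non-acute simple roots is bounded. -/
lemma sum_pair_sq_lt {γ : I → ℤ} (hγ : γ ≠ 0) (T : Finset I) (hT : ∀ p ∈ T, γ p = 0)
    (hle : ∀ p ∈ T, D.pair p γ ≤ 0) :
    ∑ p ∈ T, D.d p * D.pair p γ ^ 2 < 2 * D.form γ γ := by
  set u : I → ℤ := ∑ p ∈ T, (-D.pair p γ) • Pi.single p 1 with hu
  have hune : (2 : ℤ) • γ + u ≠ 0 := by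
    obtain ⟨i, hi⟩ := Function.ne_iff.mp hγ
    intro h0
    have h1 := congrFun h0 i
    have hiT : i ∉ T := fun h ↦ hi (hT i h)
    have : u i = 0 := by
      rw [hu, Finset.sum_apply, Finset.sum_eq_zero]
      intro p hp
      have : i ≠ p := fun h ↦ hiT (h ▸ hp)
      simp [this]
    simp only [Pi.add_apply, Pi.smul_apply, this, Pi.zero_apply] at h1 hi
    simp at h1
    exact hi h1
  have hpos := D.form_pos hune
  have h1 : D.form γ u = - ∑ p ∈ T, D.d p * D.pair p γ ^ 2 := by
    rw [hu, map_sum, ← Finset.sum_neg_distrib]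
    refine Finset.sum_congr rfl fun p _ ↦ ?_
    rw [map_smul, form_single_right]
    simp only [smul_eq_mul]; ring
  have h2 : D.form u u ≤ ∑ p ∈ T, 2 * (D.d p * D.pair p γ ^ 2) := by
    nth_rewrite 2 [hu]
    rw [map_sum]
    refine Finset.sum_le_sum fun p hp ↦ ?_
    rw [map_smul, form_single_right]
    have : D.pair p u ≤ 2 * (-D.pair p γ) := by
      rw [hu, map_sum, ← Finset.add_sum_erase _ _ hp]
      have : ∑ q ∈ T.erase p, D.pair p ((-D.pair q γ) • Pi.single q 1) ≤ 0 := by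
        refine Finset.sum_nonpos fun q hq ↦ ?_
        rw [map_smul, pair_single, smul_eq_mul]
        have := D.A_nonpos q p (Finset.ne_of_mem_erase hq)
        have := hle q (Finset.mem_of_mem_erase hq)
        nlinarith
      rw [map_smul, pair_single, D.A_self, smul_eq_mul]
      linarith
    have h3 := hle p hp
    have h4 := D.d_pos p
    rw [smul_eq_mul]
    have h5 : 0 ≤ (-D.pair p γ) * D.d p := mul_nonneg (by omega) h4.le
    nlinarith
  have h3 : D.form ((2 : ℤ) • γ + u) ((2 : ℤ) • γ + u)
      = 4 * D.form γ γ + 4 * D.form γ u + D.form u u := by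
    simp only [map_add, LinearMap.add_apply, map_smul, LinearMap.smul_apply, smul_eq_mul,
      D.form_symm u γ]
    ring
  rw [← Finset.mul_sum] at h2
  linarith

/-- `A_ij A_ji`, the weight of the edge joining `i` and `j`. -/
def bond (i j : I) : ℤ := D.A i j * D.A j i

lemma d_mul_sq (i j : I) : D.d j * D.A i j ^ 2 = D.d i * D.bond i j := by
  rw [bond]; linear_combination D.A i j * D.symm i j

lemma one_le_bond {i j : I} (hij : i ≠ j) (h : D.A i j ≠ 0) : 1 ≤ D.bond i j := by
  have h1 := D.A_nonpos i j hij
  have h2 := D.A_nonpos j i hij.symm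
  have h3 := mt (D.A_eq_zero_iff i j).mpr h
  have h4 : 0 < (-D.A i j) * (-D.A j i) := mul_pos (by omega) (by omega)
  rw [bond]; linarith

/-- A simply-laced chain of simple roots. -/
def IsChain (c : ℕ → I) (m : ℕ) : Prop :=
  ∀ s < m, ∀ t < m, D.A (c s) (c t) = if s = t then 2 else if s + 1 = t ∨ t + 1 = s then -1 else 0

variable {D}

namespace IsChain

variable {c : ℕ → I} {m : ℕ} (hc : D.IsChain c m)
include hc

lemma mono {n : ℕ} (h : n ≤ m) : D.IsChain c n :=
  fun s hs t ht ↦ hc s (by omega) t (by omega)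

lemma inj {s t : ℕ} (hs : s < m) (ht : t < m) (h : c s = c t) : s = t := by
  have h1 := hc s hs t ht
  rw [h, D.A_self] at h1
  by_contra hne
  rw [if_neg hne] at h1
  split_ifs at h1; omega

lemma d_eq {s : ℕ} (hs : s < m) : D.d (c s) = D.d (c 0) := by
  induction s with
  | zero => rfl
  | succ s ih =>
    have h := D.symm (c s) (c (s + 1))
    rw [hc s (by omega) (s + 1) hs, hc (s + 1) hs s (by omega)] at h
    simp at h
    rw [h, ih (by omega)]

lemma reverse : D.IsChain (fun s ↦ c (m - 1 - s)) m := by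
  intro s hs t ht
  rw [hc _ (by omega) _ (by omega)]
  congr 1
  · simp only [eq_iff_iff]; omega
  · congr 1; simp only [eq_iff_iff]; omega

lemma shift {k n : ℕ} (h : k + n ≤ m) : D.IsChain (fun s ↦ c (k + s)) n := by
  intro s hs t ht
  rw [hc _ (by omega) _ (by omega)]
  congr 1
  · simp
  · congr 1; simp only [eq_iff_iff]; omega

lemma cons {v : I} (h0 : 0 < m → D.A v (c 0) = -1 ∧ D.A (c 0) v = -1)
    (h : ∀ s, 0 < s → s < m → D.A v (c s) = 0) :
    D.IsChain (fun s ↦ if s = 0 then v else c (s - 1)) (m + 1) := by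
  intro s hs t ht
  obtain rfl | ⟨s, rfl⟩ : s = 0 ∨ ∃ s', s = s' + 1 := by cases s <;> simp
  · obtain rfl | ⟨t, rfl⟩ : t = 0 ∨ ∃ s', t = s' + 1 := by cases t <;> simp
    · simp [D.A_self]
    · rcases Nat.eq_zero_or_pos t with rfl | h'
      · simp [h0 (by omega)]
      · simp [h t h' (by omega)]; omega
  · obtain rfl | ⟨t, rfl⟩ : t = 0 ∨ ∃ s', t = s' + 1 := by cases t <;> simp
    · rcases Nat.eq_zero_or_pos s with rfl | h'
      · simp [h0 (by omega)]
      · simp [(D.A_eq_zero_iff _ _).mp (h s h' (by omega))]; omega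
    · simpa using hc s (by omega) t (by omega)

omit hc in
/-- The sum of consecutive roots of a chain. -/
def seg (c : ℕ → I) (i j : ℕ) : I → ℤ := ∑ t ∈ Finset.Ico i j, Pi.single (c t) 1

omit hc in
lemma pair_seg (i j : ℕ) (p : I) :
    D.pair p (seg c i j) = ∑ t ∈ Finset.Ico i j, D.A (c t) p := by
  simp [seg, map_sum]

omit [Fintype I] hc in
lemma seg_apply_eq_zero {i j : ℕ} {p : I} (h : ∀ t, i ≤ t → t < j → p ≠ c t) :
    seg c i j p = 0 := by
  rw [seg, Finset.sum_apply, Finset.sum_eq_zero]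
  intro t ht
  rw [Finset.mem_Ico] at ht
  simp [h t ht.1 ht.2]

omit hc in
lemma pair_seg_le {i j t : ℕ} {p : I} (h : ∀ t, i ≤ t → t < j → p ≠ c t) (h1 : i ≤ t) (h2 : t < j) :
    D.pair p (seg c i j) ≤ D.A (c t) p := by
  rw [pair_seg]
  have ht : t ∈ Finset.Ico i j := by simp [h1, h2]
  rw [← Finset.add_sum_erase _ _ ht]
  have : ∑ x ∈ (Finset.Ico i j).erase t, D.A (c x) p ≤ 0 := by
    refine Finset.sum_nonpos fun x hx ↦ D.A_nonpos _ _ ?_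
    have := Finset.mem_of_mem_erase hx
    rw [Finset.mem_Ico] at this
    exact (h x this.1 this.2).symm
  linarith

lemma pair_seg_of_lt {i j s : ℕ} (h : j < s) (hs : s < m) :
    D.pair (c s) (seg c i j) = 0 := by
  rw [pair_seg]
  refine Finset.sum_eq_zero fun t ht ↦ ?_
  rw [Finset.mem_Ico] at ht
  rw [hc t (by omega) s hs, if_neg (by omega), if_neg (by omega)]

lemma form_seg {i j : ℕ} (hij : i < j) (hj : j ≤ m) :
    D.form (seg c i j) (seg c i j) = 2 * D.d (c 0) := by
  induction j, hij using Nat.le_induction with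
  | base =>
    have : seg c i (i + 1) = Pi.single (c i) 1 := by simp [seg]
    rw [this]
    simp [D.A_self, hc.d_eq (show i < m by omega), mul_comm]
  | succ j hij ih =>
    have h1 : seg c i (j + 1) = seg c i j + Pi.single (c j) 1 := by
      rw [seg, Finset.sum_Ico_succ_top (by omega), seg]
    have h2 : D.pair (c j) (seg c i j) = -1 := by
      obtain ⟨j, rfl⟩ : ∃ j', j = j' + 1 := ⟨j - 1, by omega⟩
      have h3 : seg c i (j + 1) = seg c i j + Pi.single (c j) 1 := by
        rw [seg, Finset.sum_Ico_succ_top (by omega), seg]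
      rw [h3, map_add, hc.pair_seg_of_lt (by omega) (by omega), pair_single,
        hc j (by omega) _ (by omega)]
      simp
    rw [h1]
    simp only [map_add, LinearMap.add_apply, form_single_right,
      D.form_symm (Pi.single (c j) 1) (seg c i j), h2, ih (by omega), pair_single, D.A_self,
      hc.d_eq (show j < m by omega)]
    ring

lemma seg_ne_zero {i j : ℕ} (hij : i < j) (hj : j ≤ m) : seg c i j ≠ 0 := by
  intro h
  have := hc.form_seg hij hj
  rw [h] at this
  have := D.d_pos (c 0)
  simp at *
  omega

/-- The total weight of the edges joining a segment of a chain to other simple roots is at most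
three. -/
lemma star {i j : ℕ} (hij : i < j) (hj : j ≤ m) (T : Finset I) (w : I → ℤ)
    (hT : ∀ p ∈ T, ∀ t, i ≤ t → t < j → p ≠ c t)
    (hw : ∀ p ∈ T, ∃ t, i ≤ t ∧ t < j ∧ w p ≤ D.bond (c t) p) : ∑ p ∈ T, w p < 4 := by
  have h1 := D.sum_pair_sq_lt (hc.seg_ne_zero hij hj) T
    (fun p hp ↦ seg_apply_eq_zero (hT p hp)) (fun p hp ↦
      (pair_seg_le (hT p hp) le_rfl hij).trans (D.A_nonpos _ _ (hT p hp i le_rfl hij).symm))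
  rw [hc.form_seg hij hj] at h1
  have hd := D.d_pos (c 0)
  have h2 : ∑ p ∈ T, D.d (c 0) * w p ≤ ∑ p ∈ T, D.d p * D.pair p (seg c i j) ^ 2 := by
    refine Finset.sum_le_sum fun p hp ↦ ?_
    obtain ⟨t, ht1, ht2, ht⟩ := hw p hp
    have h3 := pair_seg_le (D := D) (hT p hp) ht1 ht2
    have h4 := D.A_nonpos _ _ (hT p hp t ht1 ht2).symm
    have h5 := D.d_mul_sq (c t) p
    rw [hc.d_eq (by omega)] at h5
    have h6 : D.A (c t) p ^ 2 ≤ D.pair p (seg c i j) ^ 2 := by nlinarith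
    have h7 := D.d_pos p
    nlinarith
  rw [← Finset.mul_sum] at h2
  nlinarith

lemma attached_unique {s t : ℕ} {v : I} (hst : s < t) (ht : t < m) (hv : ∀ r < m, v ≠ c r)
    (h1 : D.A (c s) v ≠ 0) (h2 : D.A (c t) v ≠ 0) : False := by
  have hT : ∀ r, 0 ≤ r → r < m → v ≠ c r := fun r _ ↦ hv r
  have h3 := D.sum_pair_sq_lt (hc.seg_ne_zero (i := 0) (by omega) le_rfl) {v}
    (by simpa using seg_apply_eq_zero hT) (by simpa using
      (pair_seg_le hT (Nat.zero_le s) (by omega)).trans (D.A_nonpos _ _ (hv s (by omega)).symm))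
  rw [hc.form_seg (by omega) le_rfl, Finset.sum_singleton, pair_seg] at h3
  have hs' : s ∈ Finset.Ico 0 m := by simp; omega
  have ht' : t ∈ (Finset.Ico 0 m).erase s := by simp; omega
  have h4 : ∑ x ∈ ((Finset.Ico 0 m).erase s).erase t, D.A (c x) v ≤ 0 := by
    refine Finset.sum_nonpos fun x hx ↦ D.A_nonpos _ _ (hv x ?_).symm
    simp at hx; omega
  rw [← Finset.add_sum_erase _ _ hs', ← Finset.add_sum_erase _ _ ht'] at h3
  set y := ∑ x ∈ ((Finset.Ico 0 m).erase s).erase t, D.A (c x) v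
  have h5 := D.one_le_bond (hv s (by omega)).symm h1
  have h6 := D.one_le_bond (hv t (by omega)).symm h2
  have h7 := D.d_mul_sq (c s) v
  have h8 := D.d_mul_sq (c t) v
  rw [hc.d_eq (by omega)] at h7 h8
  have ha := D.A_nonpos _ _ (hv s (by omega)).symm
  have hb := D.A_nonpos _ _ (hv t (by omega)).symm
  have hd := D.d_pos (c 0)
  have hdv := D.d_pos v
  set a := D.A (c s) v
  set b := D.A (c t) v
  rcases le_total a b with hab | hab
  · have : (2 * b) ^ 2 ≤ (a + (b + y)) ^ 2 := by nlinarith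
    nlinarith
  · have : (2 * a) ^ 2 ≤ (a + (b + y)) ^ 2 := by nlinarith
    nlinarith

end IsChain

/-- A finite-type Cartan matrix has no affine submatrix. -/
lemma no_affine {N : ℕ} (g : Fin N → I) (x : Fin N → ℤ) (hx : x ≠ 0)
    (hg : Function.Injective g) (h : ∀ b, ∑ a, D.A (g a) (g b) * x a = 0) : False := by
  set X : I → ℤ := ∑ a, x a • Pi.single (g a) 1 with hX
  have hXg (b) : X (g b) = x b := by
    simp [hX, Finset.sum_apply, Pi.single_apply, hg.eq_iff]
  have : X = 0 := by
    refine D.eq_zero_of_pair_eq_zero fun p hp ↦ ?_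
    have : ∃ b, g b = p := by
      by_contra! hne
      apply hp
      rw [hX, Finset.sum_apply, Finset.sum_eq_zero]
      intro a _
      simp [(hne a).symm]
    obtain ⟨b, rfl⟩ := this
    rw [hX, map_sum, ← h b]
    refine Finset.sum_congr rfl fun a _ ↦ ?_
    rw [map_smul, pair_single, smul_eq_mul, mul_comm]
  apply hx
  ext b
  rw [← hXg b, this]; rfl

end

section

variable {I : Type*} [Fintype I] [DecidableEq I] {D : FiniteCartan I}

/-- The Cartan matrix of type `A`. -/
def chainMatrix (s t : ℕ) : ℤ := if s = t then 2 else if s + 1 = t ∨ t + 1 = s then -1 else 0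

/-- Attach a node with label `N` to the node `k`, with off-diagonal entries `a` and `b`. -/
def attach (M : ℕ → ℕ → ℤ) (N k : ℕ) (a b : ℤ) (s t : ℕ) : ℤ :=
  if s = N then if t = N then 2 else if t = k then a else 0
  else if t = N then if s = k then b else 0 else M s t

variable (D) in
/-- The simple roots `g 0, …, g (N - 1)` have the Cartan matrix `M`. -/
def Realizes (g : ℕ → I) (N : ℕ) (M : ℕ → ℕ → ℤ) : Prop :=
  ∀ s < N, ∀ t < N, D.A (g s) (g t) = M s t

lemma IsChain.realizes {c : ℕ → I} {m : ℕ} (hc : D.IsChain c m) : D.Realizes c m chainMatrix := hc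

variable (D) in
/-- The node `v` is joined to the node `c k` and to no other node among the first `m`. -/
structure Attached (c : ℕ → I) (m : ℕ) (v : I) (k : ℕ) (a b : ℤ) : Prop where
  lt : k < m
  left : D.A v (c k) = a
  right : D.A (c k) v = b
  left_of_ne : ∀ s < m, s ≠ k → D.A v (c s) = 0
  right_of_ne : ∀ s < m, s ≠ k → D.A (c s) v = 0

lemma Realizes.attach {c : ℕ → I} {m : ℕ} {M : ℕ → ℕ → ℤ} (h : D.Realizes c m M) {v : I} {k : ℕ}
    {a b : ℤ} (hv : D.Attached c m v k a b) :
    D.Realizes (fun s ↦ if s = m then v else c s) (m + 1) (attach M m k a b) := by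
  intro s hs t ht
  unfold FiniteCartan.attach
  have h1 := hv.left
  have h2 := hv.right
  have h3 := hv.lt
  by_cases hsm : s = m <;> by_cases htm : t = m
  · simp [hsm, htm, D.A_self]
  · by_cases htk : t = k
    · subst htk; simp [hsm, htm, h1]
    · simp [hsm, htm, htk, hv.left_of_ne t (by omega) htk]
  · by_cases hsk : s = k
    · subst hsk; simp [hsm, htm, h2]
    · simp [hsm, htm, hsk, hv.right_of_ne s (by omega) hsk]
  · simp [hsm, htm, h s (by omega) t (by omega)]

lemma Attached.shift {c : ℕ → I} {m : ℕ} {v : I} {k : ℕ} {a b : ℤ} (i n : ℕ)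
    (hv : D.Attached c m v (i + k) a b) (h : i + n ≤ m) (hk : k < n) :
    D.Attached (fun s ↦ c (i + s)) n v k a b where
  lt := hk
  left := hv.left
  right := hv.right
  left_of_ne s _ _ := hv.left_of_ne _ (by omega) (by omega)
  right_of_ne s _ _ := hv.right_of_ne _ (by omega) (by omega)

lemma Attached.reverse {c : ℕ → I} {m : ℕ} {v : I} {k : ℕ} {a b : ℤ}
    (hv : D.Attached c m v k a b) : D.Attached (fun s ↦ c (m - 1 - s)) m v (m - 1 - k) a b := by
  have := hv.lt
  have h : m - 1 - (m - 1 - k) = k := by omega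
  exact
  { lt := by omega
    left := by rw [h]; exact hv.left
    right := by rw [h]; exact hv.right
    left_of_ne := fun s _ _ ↦ hv.left_of_ne _ (by omega) (by omega)
    right_of_ne := fun s _ _ ↦ hv.right_of_ne _ (by omega) (by omega) }

lemma Realizes.inj {g : ℕ → I} {N : ℕ} {M : ℕ → ℕ → ℤ} (h : D.Realizes g N M)
    (hM : ∀ s < N, ∀ t < N, s ≠ t → M s t ≠ 2) {s t : ℕ} (hs : s < N) (ht : t < N)
    (hst : g s = g t) : s = t := by
  by_contra hne
  apply hM s hs t ht hne
  rw [← h s hs t ht, hst, D.A_self]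

lemma Realizes.false_of_null {g : ℕ → I} {N : ℕ} {M : ℕ → ℕ → ℤ} (h : D.Realizes g N M)
    (hM : ∀ s < N, ∀ t < N, s ≠ t → M s t ≠ 2) (x : ℕ → ℤ) (hN : 0 < N) (hx : x 0 ≠ 0)
    (h0 : ∀ t < N, ∑ s ∈ Finset.range N, M s t * x s = 0) : False := by
  refine D.no_affine (fun a : Fin N ↦ g a) (fun a ↦ x a) (fun h' ↦ hx (congrFun h' ⟨0, hN⟩))
    (fun a b hab ↦ Fin.ext (h.inj hM a.2 b.2 hab)) fun b ↦ ?_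
  rw [← h0 b b.2, Finset.sum_range]
  exact Finset.sum_congr rfl fun a _ ↦ by rw [h a a.2 b b.2]

variable (D) in
/-- The Cartan matrix is, up to reordering, the matrix `M` of size `N`. -/
def HasMatrix (N : ℕ) (M : ℕ → ℕ → ℤ) : Prop :=
  ∃ e : Fin N ≃ I, ∀ a b : Fin N, D.A (e a) (e b) = M a b

lemma Realizes.hasMatrix {g : ℕ → I} {N : ℕ} {M : ℕ → ℕ → ℤ} (h : D.Realizes g N M)
    (hM : ∀ s < N, ∀ t < N, s ≠ t → M s t ≠ 2) (hg : ∀ i, ∃ s < N, i = g s) :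
    D.HasMatrix N M := by
  refine ⟨Equiv.ofBijective (fun a : Fin N ↦ g a)
    ⟨fun a b hab ↦ Fin.ext (h.inj hM a.2 b.2 hab), fun i ↦ ?_⟩, fun a b ↦ h a a.2 b b.2⟩
  obtain ⟨s, hs, rfl⟩ := hg i
  exact ⟨⟨s, hs⟩, rfl⟩

lemma bond_lt_four_cases {a b : ℤ} (ha : a ≤ 0) (hb : b ≤ 0) (h1 : 1 ≤ a * b) (h : a * b < 4) :
    (a * b = 1 ∧ a = -1 ∧ b = -1) ∨ (a * b = 2 ∧ (a = -1 ∧ b = -2 ∨ a = -2 ∧ b = -1)) ∨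
      (a * b = 3 ∧ (a = -1 ∧ b = -3 ∨ a = -3 ∧ b = -1)) := by
  have : a ≠ 0 := by rintro rfl; simp at h1
  have : b ≠ 0 := by rintro rfl; simp at h1
  have : -4 < a := by nlinarith [show a ≤ -1 by omega, show b ≤ -1 by omega]
  have : -4 < b := by nlinarith [show a ≤ -1 by omega, show b ≤ -1 by omega]
  interval_cases a <;> interval_cases b <;> simp_all

lemma isChain_const (i : I) : D.IsChain (fun _ ↦ i) 1 := by
  intro s hs t ht
  obtain rfl : s = 0 := by omega
  obtain rfl : t = 0 := by omega
  simp [D.A_self]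

lemma isChain_pair {u v : I} (h1 : D.A u v = -1) (h2 : D.A v u = -1) :
    D.IsChain (fun s ↦ if s = 0 then u else v) 2 :=
  (isChain_const v).cons (fun _ ↦ ⟨h1, h2⟩) (fun s _ _ ↦ by omega)

/-- The total weight of the edges joining a segment of a chain to nodes outside the chain. -/
lemma IsChain.star_outside {c : ℕ → I} {m : ℕ} (hc : D.IsChain c m) {i j : ℕ} (hij : i < j)
    (hj : j ≤ m) (T : Finset I) (w : I → ℤ) (hT : ∀ p ∈ T, ∀ t < m, p ≠ c t)
    (hw : ∀ p ∈ T, ∃ t, i ≤ t ∧ t < j ∧ w p ≤ D.bond (c t) p) :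
    ∑ p ∈ T, w p + (if 0 < i then 1 else 0) + (if j < m then 1 else 0) < 4 := by
  classical
  set T₁ : Finset I := if 0 < i then {c (i - 1)} else ∅ with hT₁
  set T₂ : Finset I := if j < m then {c j} else ∅ with hT₂
  have m₁ {p : I} : p ∈ T₁ ↔ 0 < i ∧ p = c (i - 1) := by rw [hT₁]; split_ifs with h <;> simp [h]
  have m₂ {p : I} : p ∈ T₂ ↔ j < m ∧ p = c j := by rw [hT₂]; split_ifs with h <;> simp [h]
  have d₁ : Disjoint T T₁ := Finset.disjoint_left.mpr fun p hp hp' ↦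
    hT p hp _ (by omega) (m₁.mp hp').2
  have d₂ : Disjoint (T ∪ T₁) T₂ := by
    refine Finset.disjoint_left.mpr fun p hp hp' ↦ ?_
    obtain ⟨h1, h2⟩ := m₂.mp hp'
    rcases Finset.mem_union.mp hp with hp | hp
    · exact hT p hp _ h1 h2
    · obtain ⟨h3, h4⟩ := m₁.mp hp
      have := hc.inj (by omega) (by omega) (h4.symm.trans h2)
      omega
  have key := hc.star hij hj (T ∪ T₁ ∪ T₂) (fun p ↦ if p ∈ T then w p else 1) ?_ ?_
  · rw [Finset.sum_union d₂, Finset.sum_union d₁] at key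
    have e0 : ∑ p ∈ T, (if p ∈ T then w p else 1) = ∑ p ∈ T, w p :=
      Finset.sum_congr rfl fun p hp ↦ by simp [hp]
    have e1 : ∑ p ∈ T₁, (if p ∈ T then w p else 1) = if 0 < i then 1 else 0 := by
      rw [Finset.sum_congr rfl (g := fun _ ↦ (1 : ℤ)) fun p hp ↦ by
        simp [Finset.disjoint_right.mp d₁ hp]]
      rw [hT₁]; split_ifs <;> simp
    have e2 : ∑ p ∈ T₂, (if p ∈ T then w p else 1) = if j < m then 1 else 0 := by
      rw [Finset.sum_congr rfl (g := fun _ ↦ (1 : ℤ)) fun p hp ↦ by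
        have := Finset.disjoint_right.mp d₂ hp
        simp at this
        simp [this]]
      rw [hT₂]; split_ifs <;> simp
    rw [e0, e1, e2] at key
    exact key
  · intro p hp t h1 h2
    simp only [Finset.mem_union] at hp
    rcases hp with (hp | hp) | hp
    · exact hT p hp t (by omega)
    · obtain ⟨h3, rfl⟩ := m₁.mp hp
      intro h
      have := hc.inj (by omega) (by omega) h
      omega
    · obtain ⟨h3, rfl⟩ := m₂.mp hp
      intro h
      have := hc.inj (by omega) (by omega) h
      omega
  · intro p hp
    by_cases hpT : p ∈ T
    · obtain ⟨t, h1, h2, h3⟩ := hw p hpT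
      exact ⟨t, h1, h2, by simpa [hpT] using h3⟩
    simp only [Finset.mem_union, hpT, false_or] at hp
    rcases hp with hp | hp
    · obtain ⟨h3, rfl⟩ := m₁.mp hp
      refine ⟨i, le_rfl, hij, ?_⟩
      simp only [hpT, if_false]
      rw [bond, hc _ (by omega) _ (by omega), hc _ (by omega) _ (by omega), if_neg (by omega),
        if_pos (by omega), if_neg (by omega), if_pos (by omega)]
      simp
    · obtain ⟨h3, rfl⟩ := m₂.mp hp
      refine ⟨j - 1, by omega, by omega, ?_⟩
      simp only [hpT, if_false]
      rw [bond, hc _ (by omega) _ (by omega), hc _ (by omega) _ (by omega), if_neg (by omega),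
        if_pos (by omega), if_neg (by omega), if_pos (by omega)]
      simp

variable (D) in
/-- A chain of maximal length. -/
structure IsMaxChain (c : ℕ → I) (m : ℕ) : Prop where
  isChain : D.IsChain c m
  pos : 0 < m
  max : ∀ c' n, D.IsChain c' n → n ≤ m

variable (D) in
lemma exists_isMaxChain [Nonempty I] : ∃ c m, D.IsMaxChain c m := by
  classical
  obtain ⟨i⟩ := ‹Nonempty I›
  let P : ℕ → Prop := fun n ↦ ∃ c, D.IsChain c n
  have hle : ∀ n, P n → n ≤ Fintype.card I := by
    rintro n ⟨c, hc⟩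
    simpa using Fintype.card_le_of_injective (fun a : Fin n ↦ c a)
      fun a b hab ↦ Fin.ext (hc.inj a.2 b.2 hab)
  have h1 : P 1 := ⟨_, isChain_const i⟩
  obtain ⟨c, hc⟩ := Nat.findGreatest_spec (hle 1 h1) h1
  exact ⟨c, _, hc, Nat.le_findGreatest (hle 1 h1) h1,
    fun c' n h ↦ Nat.le_findGreatest (hle n ⟨c', h⟩) ⟨c', h⟩⟩

namespace IsMaxChain

variable {c : ℕ → I} {m : ℕ} (hc : D.IsMaxChain c m)
include hc

lemma reverse : D.IsMaxChain (fun s ↦ c (m - 1 - s)) m :=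
  ⟨hc.isChain.reverse, hc.pos, hc.max⟩

lemma attached {v : I} (hv : ∀ s < m, v ≠ c s) {k : ℕ} (hk : k < m) (h : D.A (c k) v ≠ 0) :
    D.Attached c m v k (D.A v (c k)) (D.A (c k) v) := by
  have h0 (s : ℕ) (hs : s < m) (hsk : s ≠ k) : D.A (c s) v = 0 := by
    by_contra h'
    rcases lt_or_gt_of_ne hsk with h1 | h1
    · exact hc.isChain.attached_unique h1 hk hv h' h
    · exact hc.isChain.attached_unique h1 hs hv h h'
  exact ⟨hk, rfl, rfl, fun s hs hsk ↦ (D.A_eq_zero_iff _ _).mp (h0 s hs hsk), h0⟩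

lemma two_le_bond_zero {v : I} (hv : ∀ s < m, v ≠ c s) (h : D.A (c 0) v ≠ 0) :
    2 ≤ D.bond (c 0) v := by
  have h1 := D.one_le_bond (hv 0 hc.pos).symm h
  by_contra! h2
  have h3 : D.bond (c 0) v = 1 := by omega
  have ha := hc.attached hv hc.pos h
  rcases bond_lt_four_cases (D.A_nonpos _ _ (hv 0 hc.pos).symm) (D.A_nonpos _ _ (hv 0 hc.pos)) h1
    (show D.bond (c 0) v < 4 by omega) with h | h | h
  · have := hc.max _ _ (hc.isChain.cons (v := v) (fun _ ↦ ⟨h.2.2, h.2.1⟩)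
      fun s hs hsm ↦ ha.left_of_ne s hsm (by omega))
    omega
  all_goals
    have := h.1
    rw [← bond] at this
    omega

lemma two_le_bond_end {v : I} (hv : ∀ s < m, v ≠ c s) (h : D.A (c (m - 1)) v ≠ 0) :
    2 ≤ D.bond (c (m - 1)) v :=
  hc.reverse.two_le_bond_zero (fun s hs ↦ hv _ (by omega)) h

lemma unique_aux {v v' : I} (hv : ∀ s < m, v ≠ c s) (hv' : ∀ s < m, v' ≠ c s) (hne : v ≠ v')
    {k k' : ℕ} (hkk : k ≤ k') (hk' : k' < m) (h : D.A (c k) v ≠ 0) (h' : D.A (c k') v' ≠ 0) :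
    False := by
  have key := hc.isChain.star_outside (i := k) (j := k' + 1) (by omega) (by omega) {v, v'}
    (fun p ↦ if p = v then D.bond (c k) v else D.bond (c k') v') (by
      rintro p hp t ht
      simp at hp
      rcases hp with rfl | rfl
      · exact hv t ht
      · exact hv' t ht) (by
      rintro p hp
      simp at hp
      rcases hp with rfl | rfl
      · exact ⟨k, le_rfl, by omega, by simp⟩
      · exact ⟨k', by omega, by omega, by simp [hne.symm]⟩)
  rw [Finset.sum_pair hne] at key
  simp only [if_true, if_neg hne.symm] at key
  have b1 : 2 ≤ D.bond (c k) v + if 0 < k then 1 else 0 := by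
    rcases Nat.eq_zero_or_pos k with rfl | hk
    · simpa using hc.two_le_bond_zero hv h
    · have := D.one_le_bond (hv k (by omega)).symm h
      simp [hk]; omega
  have b2 : 2 ≤ D.bond (c k') v' + if k' + 1 < m then 1 else 0 := by
    by_cases hk : k' + 1 < m
    · have := D.one_le_bond (hv' k' (by omega)).symm h'
      simp [hk]; omega
    · obtain rfl : k' = m - 1 := by omega
      simpa [hk] using hc.two_le_bond_end hv' h'
  omega

/-- At most one node outside a maximal chain is joined to it. -/
lemma unique {v v' : I} (hv : ∀ s < m, v ≠ c s) (hv' : ∀ s < m, v' ≠ c s)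
    {k k' : ℕ} (hk : k < m) (hk' : k' < m) (h : D.A (c k) v ≠ 0) (h' : D.A (c k') v' ≠ 0) :
    v = v' := by
  by_contra hne
  rcases le_total k k' with hkk | hkk
  · exact hc.unique_aux hv hv' hne hkk hk' h h'
  · exact hc.unique_aux hv' hv (Ne.symm hne) hkk hk h' h

lemma bond_add_lt {v : I} (hv : ∀ s < m, v ≠ c s) {k : ℕ} (hk : k < m) :
    D.bond (c k) v + (if 0 < k then 1 else 0) + (if k + 1 < m then 1 else 0) < 4 := by
  simpa using hc.isChain.star_outside (i := k) (j := k + 1) (by omega) (by omega) {v}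
    (fun _ ↦ D.bond (c k) v) (by simpa using hv) (by simpa using ⟨k, le_rfl, le_rfl, le_rfl⟩)

end IsMaxChain

end

section

variable {I : Type*} [Fintype I] [DecidableEq I] {D : FiniteCartan I}

/-- The Cartan matrix of type `E`, of rank `N + 1`. -/
def matrixE (N : ℕ) : ℕ → ℕ → ℤ := attach chainMatrix N 2 (-1) (-1)

/-- The Cartan matrix of type `F₄`. -/
def matrixF : ℕ → ℕ → ℤ := attach (attach chainMatrix 2 1 (-1) (-2)) 3 2 (-1) (-1)

/-- The Cartan matrix of type `G₂`. -/
def matrixG : ℕ → ℕ → ℤ := attach chainMatrix 1 0 (-3) (-1)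

/-- The classification of the connected Dynkin diagrams. -/
inductive Classified (D : FiniteCartan I) : Prop
  | typeA (c : ℕ → I) (m : ℕ) (hm : 0 < m) (hc : D.IsChain c m) (h : ∀ i, ∃ s < m, i = c s)
  | typeB (c : ℕ → I) (m : ℕ) (v : I) (hm : 2 ≤ m) (hc : D.IsChain c m)
      (hv : D.Attached c m v (m - 1) (-1) (-2)) (h : ∀ i, i = v ∨ ∃ s < m, i = c s)
  | typeC (c : ℕ → I) (m : ℕ) (v : I) (hm : 1 ≤ m) (hc : D.IsChain c m)
      (hv : D.Attached c m v (m - 1) (-2) (-1)) (h : ∀ i, i = v ∨ ∃ s < m, i = c s)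
  | typeD (c : ℕ → I) (m : ℕ) (v : I) (hm : 3 ≤ m) (hc : D.IsChain c m)
      (hv : D.Attached c m v (m - 2) (-1) (-1)) (h : ∀ i, i = v ∨ ∃ s < m, i = c s)
  | typeE₆ (h : D.HasMatrix 6 (matrixE 5))
  | typeE₇ (h : D.HasMatrix 7 (matrixE 6))
  | typeE₈ (h : D.HasMatrix 8 (matrixE 7))
  | typeF₄ (h : D.HasMatrix 4 matrixF)
  | typeG₂ (h : D.HasMatrix 2 matrixG)

lemma false_of_E₆_tilde {c : ℕ → I} {v w : I} (hc : D.IsChain c 5)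
    (hv : D.Attached c 5 v 2 (-1) (-1))
    (hw : D.Attached (fun s ↦ if s = 5 then v else c s) 6 w 5 (-1) (-1)) : False :=
  ((hc.realizes.attach hv).attach hw).false_of_null (by decide)
    (fun s ↦ [1, 2, 3, 2, 1, 2, 1].getD s 0) (by norm_num) (by decide) (by decide)

lemma false_of_E₇_tilde {c : ℕ → I} {v : I} (hc : D.IsChain c 7)
    (hv : D.Attached c 7 v 3 (-1) (-1)) : False :=
  (hc.realizes.attach hv).false_of_null (by decide)
    (fun s ↦ [1, 2, 3, 4, 3, 2, 1, 2].getD s 0) (by norm_num) (by decide) (by decide)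

lemma false_of_E₈_tilde {c : ℕ → I} {v : I} (hc : D.IsChain c 8)
    (hv : D.Attached c 8 v 2 (-1) (-1)) : False :=
  (hc.realizes.attach hv).false_of_null (by decide)
    (fun s ↦ [2, 4, 6, 5, 4, 3, 2, 1, 3].getD s 0) (by norm_num) (by decide) (by decide)

lemma false_of_F₄_tilde {c : ℕ → I} {v w : I} {a b : ℤ} (hc : D.IsChain c 3)
    (hv : D.Attached c 3 v 2 a b) (hab : a = -1 ∧ b = -2 ∨ a = -2 ∧ b = -1)
    (hw : D.Attached (fun s ↦ if s = 3 then v else c s) 4 w 3 (-1) (-1)) : False := by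
  rcases hab with ⟨rfl, rfl⟩ | ⟨rfl, rfl⟩
  · exact ((hc.realizes.attach hv).attach hw).false_of_null (by decide)
      (fun s ↦ [1, 2, 3, 4, 2].getD s 0) (by norm_num) (by decide) (by decide)
  · exact ((hc.realizes.attach hv).attach hw).false_of_null (by decide)
      (fun s ↦ [1, 2, 3, 2, 1].getD s 0) (by norm_num) (by decide) (by decide)

/-- Nodes not joined to a set of nodes do not occur outside it. -/
lemma exists_adjacent (p : I → Prop) {i : I} (hi : p i) (h : ¬ ∀ j, p j) :
    ∃ j k, p j ∧ ¬ p k ∧ D.A k j ≠ 0 := by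
  by_contra! hne
  refine h fun j ↦ D.connected p i j hi fun j k hj hkj ↦ ?_
  by_contra hk
  exact hkj (hne j k hj hk)

lemma Attached.extend {c : ℕ → I} {m : ℕ} {v w : I} (hw : ∀ s < m, D.A (c s) w = 0) :
    D.Attached (fun s ↦ if s = m then v else c s) (m + 1) w m (D.A w v) (D.A v w) where
  lt := by omega
  left := by simp
  right := by simp
  left_of_ne s hs hsm := by
    simp only [if_neg hsm]
    exact (D.A_eq_zero_iff _ _).mp (hw s (by omega))
  right_of_ne s hs hsm := by
    simp only [if_neg hsm]
    exact hw s (by omega)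

lemma star_node (u : I) (T : Finset I) (hT : u ∉ T) : ∑ p ∈ T, D.bond u p < 4 :=
  (isChain_const u).star (i := 0) (j := 1) one_pos le_rfl T (fun p ↦ D.bond u p)
    (fun _ hp _ _ _ h ↦ hT (h ▸ hp)) fun _ _ ↦ ⟨0, le_rfl, one_pos, le_rfl⟩

namespace IsMaxChain

variable {c : ℕ → I} {m : ℕ} (hc : D.IsMaxChain c m)
include hc

/-- The bond cases for a node joined to a maximal chain, which we may
assume nearer to the left end. -/
lemma bond_cases {v : I} (hv : ∀ s < m, v ≠ c s) {k : ℕ} (hk : 2 * k + 1 ≤ m)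
    (h : D.A (c k) v ≠ 0) :
    (0 < k ∧ D.Attached c m v k (-1) (-1)) ∨
    (k = 0 ∧ ∃ a b, D.Attached c m v 0 a b ∧ (a = -1 ∧ b = -2 ∨ a = -2 ∧ b = -1)) ∨
    (k = 0 ∧ m = 1 ∧ ∃ a b, D.Attached c m v 0 a b ∧ (a = -1 ∧ b = -3 ∨ a = -3 ∧ b = -1)) := by
  have hkm : k < m := by omega
  have h1 := hc.bond_add_lt hv hkm
  have h2 := D.one_le_bond (hv k hkm).symm h
  have h3 := bond_lt_four_cases (D.A_nonpos _ _ (hv k hkm).symm) (D.A_nonpos _ _ (hv k hkm)) h2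
    (show D.bond (c k) v < 4 by split_ifs at h1 <;> omega)
  have ha := hc.attached hv hkm h
  rw [← bond] at h3
  rcases Nat.eq_zero_or_pos k with rfl | hk0
  · have h4 := hc.two_le_bond_zero hv h
    rcases h3 with h3 | h3 | h3
    · omega
    · exact Or.inr (Or.inl ⟨rfl, _, _, ha, by tauto⟩)
    · refine Or.inr (Or.inr ⟨rfl, ?_, _, _, ha, by tauto⟩)
      split_ifs at h1 <;> omega
  · rw [if_pos hk0, if_pos (by omega)] at h1
    rcases h3 with h3 | h3 | h3
    · rw [h3.2.1, h3.2.2] at ha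
      exact Or.inl ⟨hk0, ha⟩
    all_goals omega

/-- A branched diagram is a chain together with one further node. -/
lemma cover_of_pos {v : I} (hv : ∀ s < m, v ≠ c s) {k : ℕ} (hk : 2 * k + 1 ≤ m) (hk0 : 0 < k)
    (ha : D.Attached c m v k (-1) (-1)) : ∀ i, i = v ∨ ∃ s < m, i = c s := by
  by_contra hcov
  obtain ⟨u, w, hu, hw, huw⟩ := D.exists_adjacent (fun i ↦ i = v ∨ ∃ s < m, i = c s)
    (Or.inl (Eq.refl v)) hcov
  push Not at hw
  obtain ⟨hwv, hw⟩ := hw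
  have hcw (s : ℕ) (hs : s < m) : D.A (c s) w = 0 := by
    by_contra h'
    exact hwv (hc.unique hw hv hs ha.lt h' (by rw [ha.right]; norm_num))
  rcases hu with rfl | ⟨s, hs, rfl⟩
  swap
  · exact huw ((D.A_eq_zero_iff _ _).mp (hcw s hs))
  have hmk : k < m := ha.lt
  have hch := isChain_pair ha.left ha.right
  have hc1 : c (k - 1) ≠ c (k + 1) := fun h ↦ by
    have := hc.isChain.inj (by omega) (by omega) h; omega
  have hw1 : w ≠ c (k - 1) := hw _ (by omega)
  have hw2 : w ≠ c (k + 1) := hw _ (by omega)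
  have key := hch.star (i := 0) (j := 2) (by omega) le_rfl {w, c (k - 1), c (k + 1)}
    (fun p ↦ if p = w then D.bond u w else 1) (by
      intro p hp t _ ht
      simp only [Finset.mem_insert, Finset.mem_singleton] at hp
      rcases Nat.eq_zero_or_pos t with rfl | ht0
      · rcases hp with rfl | rfl | rfl
        · simpa using hwv
        · simpa using (hv (k - 1) (by omega)).symm
        · simpa using (hv (k + 1) (by omega)).symm
      · rw [if_neg (by omega)]
        rcases hp with rfl | rfl | rfl
        · exact hw k hmk
        · exact fun h ↦ by have := hc.isChain.inj (by omega) (by omega) h; omega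
        · exact fun h ↦ by have := hc.isChain.inj (by omega) (by omega) h; omega) (by
      intro p hp
      simp only [Finset.mem_insert, Finset.mem_singleton] at hp
      rcases hp with rfl | rfl | rfl
      · exact ⟨0, by simp⟩
      · refine ⟨1, by simp, by simp, ?_⟩
        rw [if_neg hw1.symm, if_neg one_ne_zero, bond, hc.isChain _ hmk _ (by omega),
          hc.isChain _ (by omega) _ hmk, if_neg (by omega), if_pos (by omega),
          if_neg (by omega), if_pos (by omega)]
        norm_num
      · refine ⟨1, by simp, by simp, ?_⟩
        rw [if_neg hw2.symm, if_neg one_ne_zero, bond, hc.isChain _ hmk _ (by omega),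
          hc.isChain _ (by omega) _ hmk, if_neg (by omega), if_pos (by omega),
          if_neg (by omega), if_pos (by omega)]
        norm_num)
  rw [Finset.sum_insert (by simp [hw1, hw2]), Finset.sum_pair hc1, if_pos rfl, if_neg hw1.symm,
    if_neg hw2.symm] at key
  have hb := bond_lt_four_cases (D.A_nonpos u w hwv.symm) (D.A_nonpos w u hwv)
    (D.one_le_bond hwv.symm (mt (D.A_eq_zero_iff _ _).mp huw)) (show D.bond u w < 4 by omega)
  rw [← bond] at hb
  obtain ⟨-, h1, h2⟩ : D.bond u w = 1 ∧ D.A u w = -1 ∧ D.A w u = -1 := by omega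
  have hex := Attached.extend (v := u) hcw
  have hlong := ((hc.isChain.shift (k := k) (n := m - k) (by omega)).cons (v := u)
    (fun _ ↦ ⟨ha.left, ha.right⟩)
    (fun s h0 hs ↦ ha.left_of_ne (k + s) (by omega) (by omega))).cons (v := w)
    (fun _ ↦ by simpa using ⟨h2, h1⟩) (fun s h0 hs ↦ by
      rw [if_neg (by omega)]
      exact (D.A_eq_zero_iff _ _).mp (hcw _ (by omega)))
  have hlen := hc.max _ _ hlong
  have ha' : D.Attached c m u (k - 2 + 2) (-1) (-1) := by
    rwa [show k - 2 + 2 = k by omega]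
  refine false_of_E₆_tilde (w := w) (hc.isChain.shift (k := k - 2) (n := 5) (by omega))
    (ha'.shift (k - 2) 5 (by omega) (by omega)) ?_
  have := Attached.extend (v := u) (c := fun s ↦ c (k - 2 + s)) (m := 5) (w := w)
    fun s hs ↦ hcw _ (by omega)
  rwa [h1, h2] at this

end IsMaxChain

end

section

variable {I : Type*} [Fintype I] [DecidableEq I] {D : FiniteCartan I}

lemma hasMatrix_G {u v : I} (h1 : D.A v u = -3) (h2 : D.A u v = -1) (h : ∀ i, i = v ∨ i = u) :
    D.HasMatrix 2 matrixG := by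
  have ha : D.Attached (fun _ ↦ u) 1 v 0 (-3) (-1) := ⟨one_pos, h1, h2, by omega, by omega⟩
  refine ((isChain_const u).realizes.attach ha).hasMatrix (by decide) fun i ↦ ?_
  rcases h i with rfl | rfl
  · exact ⟨1, by simp, by simp⟩
  · exact ⟨0, by simp, by simp⟩

namespace IsMaxChain

variable {c : ℕ → I} {m : ℕ} (hc : D.IsMaxChain c m)
include hc

/-- A multiply laced diagram with a node outside a maximal chain and its neighbour is of type
`F₄`. -/
lemma hasMatrix_F_of_zero {v w : I} (hv : ∀ s < m, v ≠ c s) {a b : ℤ}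
    (ha : D.Attached c m v 0 a b) (hab : a = -1 ∧ b = -2 ∨ a = -2 ∧ b = -1)
    (hwv : w ≠ v) (hw : ∀ s < m, w ≠ c s) (huw : D.A w v ≠ 0) : D.HasMatrix 4 matrixF := by
  have hm := hc.pos
  have hunique {x : I} (hx : ∀ s < m, x ≠ c s) (hxv : x ≠ v) (s : ℕ) (hs : s < m) :
      D.A (c s) x = 0 := by
    by_contra h'
    exact hxv (hc.unique hx hv hs hm h' (by rw [ha.right]; omega))
  have hcw := hunique hw hwv
  have hb0 : D.bond v (c 0) = 2 := by
    rw [bond, ha.left, ha.right]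
    rcases hab with ⟨rfl, rfl⟩ | ⟨rfl, rfl⟩ <;> norm_num
  have hone := D.one_le_bond hwv.symm (mt (D.A_eq_zero_iff _ _).mp huw)
  have key := D.star_node v {c 0, w} (by simp [hv 0 hm, hwv.symm])
  rw [Finset.sum_pair (hw 0 hm).symm] at key
  have hb := bond_lt_four_cases (D.A_nonpos v w hwv.symm) (D.A_nonpos w v hwv) hone
    (show D.bond v w < 4 by omega)
  rw [← bond] at hb
  obtain ⟨-, h1, h2⟩ : D.bond v w = 1 ∧ D.A v w = -1 ∧ D.A w v = -1 := by omega
  have hvw := isChain_pair h1 h2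
  have hm2 : 2 ≤ m := hc.max _ _ hvw
  obtain rfl : m = 2 := by
    by_contra hm3
    have h3 : 3 ≤ m := by omega
    have hc3 := (hc.isChain.mono h3).reverse
    have ha3 : D.Attached (fun s ↦ c (3 - 1 - s)) 3 v 2 a b :=
      (ha.shift (k := 0) 0 3 (by omega) (by omega) |> fun h ↦
        (⟨h.lt, h.left, h.right, fun s h4 ↦ by simpa using h.left_of_ne s h4,
          fun s h4 ↦ by simpa using h.right_of_ne s h4⟩ : D.Attached c 3 v 0 a b)).reverse
    refine false_of_F₄_tilde (w := w) hc3 ha3 hab ?_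
    have := Attached.extend (v := v) (c := fun s ↦ c (3 - 1 - s)) (m := 3) (w := w)
      fun s hs ↦ hcw _ (by omega)
    rwa [h1, h2] at this
  have hcov : ∀ i, i = v ∨ i = w ∨ i = c 0 ∨ i = c 1 := by
    by_contra hcov
    obtain ⟨u, x, hu, hx, hux⟩ := D.exists_adjacent
      (fun i ↦ i = v ∨ i = w ∨ i = c 0 ∨ i = c 1) (Or.inl (Eq.refl v)) hcov
    push Not at hx
    obtain ⟨hxv, hxw, hx0, hx1⟩ := hx
    have hxc : ∀ s < 2, x ≠ c s := fun s hs ↦ by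
      interval_cases s <;> assumption
    have hcx := hunique hxc hxv
    rcases hu with rfl | rfl | rfl | rfl
    · have key := D.star_node u {c 0, w, x} (by simp [hv 0 hm, hwv.symm, hxv.symm])
      rw [Finset.sum_insert (by simp [(hw 0 hm).symm, hx0.symm]), Finset.sum_pair hxw.symm] at key
      have := D.one_le_bond hxv.symm (mt (D.A_eq_zero_iff _ _).mp hux)
      omega
    · have hone := D.one_le_bond hxw.symm (mt (D.A_eq_zero_iff _ _).mp hux)
      have hvx : D.A v x = 0 := by
        by_contra hvx
        have key := D.star_node v {c 0, u, x} (by simp [hv 0 hm, hwv.symm, hxv.symm])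
        rw [Finset.sum_insert (by simp [(hw 0 hm).symm, hx0.symm]), Finset.sum_pair hxw.symm] at key
        have := D.one_le_bond hxv.symm hvx
        omega
      have key := hvw.star (i := 0) (j := 2) (by omega) le_rfl {c 0, x}
        (fun p ↦ if p = x then D.bond u x else 2) (by
          intro p hp t _ ht
          simp only [Finset.mem_insert, Finset.mem_singleton] at hp
          split_ifs
          · rcases hp with rfl | rfl
            · exact (hv 0 hm).symm
            · exact hxv
          · rcases hp with rfl | rfl
            · exact (hw 0 hm).symm
            · exact hxw) (by
          intro p hp
          simp only [Finset.mem_insert, Finset.mem_singleton] at hp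
          rcases hp with rfl | rfl
          · exact ⟨0, by simp, by simp, by simp [hx0.symm, hb0]⟩
          · exact ⟨1, by simp, by simp, by simp⟩)
      rw [Finset.sum_pair hx0.symm, if_pos rfl, if_neg hx0.symm] at key
      have hb := bond_lt_four_cases (D.A_nonpos u x hxw.symm) (D.A_nonpos x u hxw) hone
        (show D.bond u x < 4 by omega)
      rw [← bond] at hb
      obtain ⟨-, h3, h4⟩ : D.bond u x = 1 ∧ D.A u x = -1 ∧ D.A x u = -1 := by omega
      have := hc.max _ _ ((isChain_pair h2 h1).cons (v := x) (fun _ ↦ by simp [h3, h4])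
        (fun s h0 hs ↦ by
          obtain rfl : s = 1 := by omega
          simpa using (D.A_eq_zero_iff _ _).mp hvx))
      omega
    · exact hux ((D.A_eq_zero_iff _ _).mp (hcx 0 (by omega)))
    · exact hux ((D.A_eq_zero_iff _ _).mp (hcx 1 (by omega)))
  rcases hab with ⟨rfl, rfl⟩ | ⟨rfl, rfl⟩
  · have ha2 := ha.reverse
    have ex := Attached.extend (v := v) (c := fun s ↦ c (2 - 1 - s)) (m := 2) (w := w)
      fun s hs ↦ hcw _ (by omega)
    rw [h1, h2] at ex
    refine ((hc.isChain.reverse.realizes.attach ha2).attach ex).hasMatrix (by decide) fun i ↦ ?_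
    rcases hcov i with rfl | rfl | rfl | rfl
    · exact ⟨2, by simp, by simp⟩
    · exact ⟨3, by simp, by simp⟩
    · exact ⟨1, by simp, by simp⟩
    · exact ⟨0, by simp, by simp⟩
  · have hwv' := isChain_pair h2 h1
    have hw0 := hcw 0 (by omega)
    have hw1 := hcw 1 (by omega)
    have hv1 := ha.right_of_ne 1 (by omega) (by omega)
    have e1 : D.Attached (fun s ↦ if s = 0 then w else v) 2 (c 0) 1 (-1) (-2) :=
      ⟨by omega, by simpa using ha.right, by simpa using ha.left,
        fun s hs hs1 ↦ by obtain rfl : s = 0 := by omega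
                          simpa using hw0,
        fun s hs hs1 ↦ by obtain rfl : s = 0 := by omega
                          simpa using (D.A_eq_zero_iff _ _).mp hw0⟩
    have e2 := Attached.extend (v := c 0) (c := fun s ↦ if s = 0 then w else v) (m := 2)
      (w := c 1) fun s hs ↦ by
        split_ifs
        · exact (D.A_eq_zero_iff _ _).mp hw1
        · exact (D.A_eq_zero_iff _ _).mp hv1
    rw [hc.isChain 1 (by omega) 0 (by omega), hc.isChain 0 (by omega) 1 (by omega)] at e2
    simp only [one_ne_zero, zero_ne_one, if_false, zero_add, or_true, true_or, if_true] at e2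
    refine ((hwv'.realizes.attach e1).attach e2).hasMatrix (by decide) fun i ↦ ?_
    rcases hcov i with rfl | rfl | rfl | rfl
    · exact ⟨1, by simp, by simp⟩
    · exact ⟨0, by simp, by simp⟩
    · exact ⟨2, by simp, by simp⟩
    · exact ⟨3, by simp, by simp⟩

lemma classified_of_pos {v : I} (hv : ∀ s < m, v ≠ c s) {k : ℕ} (hk : 2 * k + 1 ≤ m) (hk0 : 0 < k)
    (ha : D.Attached c m v k (-1) (-1)) : D.Classified := by
  have hcov := hc.cover_of_pos hv hk hk0 ha
  have hcov' (i : I) : ∃ s < m + 1, i = if s = m then v else c s := by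
    rcases hcov i with rfl | ⟨s, hs, rfl⟩
    · exact ⟨m, by omega, by simp⟩
    · exact ⟨s, by omega, by rw [if_neg (by omega)]⟩
  obtain rfl | rfl | h3 : k = 1 ∨ k = 2 ∨ 3 ≤ k := by omega
  · refine .typeD _ m v hk hc.isChain.reverse (by simpa [Nat.sub_sub] using ha.reverse)
      fun i ↦ (hcov i).imp_right ?_
    rintro ⟨s, hs, rfl⟩
    exact ⟨m - 1 - s, by omega, by rw [show m - 1 - (m - 1 - s) = s by omega]⟩
  · by_cases hm : 8 ≤ m
    · have ha' : D.Attached c m v (0 + 2) (-1) (-1) := ha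
      exact (false_of_E₈_tilde (hc.isChain.shift (k := 0) (n := 8) (by omega))
        (ha'.shift 0 8 (by omega) (by omega))).elim
    · have hR := hc.isChain.realizes.attach ha
      obtain rfl | rfl | rfl : m = 5 ∨ m = 6 ∨ m = 7 := by omega
      · exact .typeE₆ (hR.hasMatrix (by decide) hcov')
      · exact .typeE₇ (hR.hasMatrix (by decide) hcov')
      · exact .typeE₈ (hR.hasMatrix (by decide) hcov')
  · have ha' : D.Attached c m v (k - 3 + 3) (-1) (-1) := by
      rwa [show k - 3 + 3 = k by omega]
    exact (false_of_E₇_tilde (hc.isChain.shift (k := k - 3) (n := 7) (by omega))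
        (ha'.shift (k - 3) 7 (by omega) (by omega))).elim

lemma classified_of_near {v : I} (hv : ∀ s < m, v ≠ c s) {k : ℕ} (hk : 2 * k + 1 ≤ m)
    (h : D.A (c k) v ≠ 0) : D.Classified := by
  have hm := hc.pos
  have hadj (hcov : ¬ ∀ i, i = v ∨ ∃ s < m, i = c s) :
      ∃ w, w ≠ v ∧ (∀ s < m, w ≠ c s) ∧ D.A w v ≠ 0 := by
    obtain ⟨u, w, hu, hw, huw⟩ := D.exists_adjacent (fun i ↦ i = v ∨ ∃ s < m, i = c s)
      (Or.inl (Eq.refl v)) hcov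
    push Not at hw
    refine ⟨w, hw.1, hw.2, ?_⟩
    rcases hu with rfl | ⟨s, hs, rfl⟩
    · exact huw
    · exact (hw.1 (hc.unique hw.2 hv hs (by omega) (mt (D.A_eq_zero_iff _ _).mp huw) h)).elim
  rcases hc.bond_cases hv hk h with ⟨hk0, ha⟩ | ⟨rfl, a, b, ha, hab⟩ | ⟨rfl, rfl, a, b, ha, hab⟩
  · exact hc.classified_of_pos hv hk hk0 ha
  · by_cases hcov : ∀ i, i = v ∨ ∃ s < m, i = c s
    · have hcov' (i : I) : i = v ∨ ∃ s < m, i = c (m - 1 - s) := by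
        refine (hcov i).imp_right ?_
        rintro ⟨s, hs, rfl⟩
        exact ⟨m - 1 - s, by omega, by rw [show m - 1 - (m - 1 - s) = s by omega]⟩
      rcases hab with ⟨rfl, rfl⟩ | ⟨rfl, rfl⟩
      · by_cases hm2 : 2 ≤ m
        · exact .typeB _ m v hm2 hc.isChain.reverse (by simpa using ha.reverse) hcov'
        · obtain rfl : m = 1 := by omega
          refine .typeC (fun _ ↦ v) 1 (c 0) le_rfl (isChain_const v)
            ⟨one_pos, ha.right, ha.left, by omega, by omega⟩ fun i ↦ ?_
          rcases hcov i with rfl | ⟨s, hs, rfl⟩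
          · exact Or.inr ⟨0, one_pos, rfl⟩
          · obtain rfl : s = 0 := by omega
            exact Or.inl rfl
      · exact .typeC _ m v hm hc.isChain.reverse (by simpa using ha.reverse) hcov'
    · obtain ⟨w, h1, h2, h3⟩ := hadj hcov
      exact .typeF₄ (hc.hasMatrix_F_of_zero hv ha hab h1 h2 h3)
  · by_cases hcov : ∀ i, i = v ∨ ∃ s < 1, i = c s
    · have hcov' (i : I) : i = v ∨ i = c 0 := by simpa using hcov i
      rcases hab with ⟨rfl, rfl⟩ | ⟨rfl, rfl⟩
      · exact .typeG₂ (hasMatrix_G ha.right ha.left fun i ↦ (hcov' i).symm)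
      · exact .typeG₂ (hasMatrix_G ha.left ha.right hcov')
    · obtain ⟨w, h1, h2, h3⟩ := hadj hcov
      have key := D.star_node v {c 0, w} (by simp [hv 0 hm, h1.symm])
      rw [Finset.sum_pair (h2 0 hm).symm] at key
      have hone := D.one_le_bond h1.symm (mt (D.A_eq_zero_iff _ _).mp h3)
      have hb0 : D.bond v (c 0) = 3 := by
        rw [bond, ha.left, ha.right]
        rcases hab with ⟨rfl, rfl⟩ | ⟨rfl, rfl⟩ <;> norm_num
      omega

lemma classified : D.Classified := by
  have hm := hc.pos
  by_cases hcov : ∀ i, ∃ s < m, i = c s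
  · exact .typeA c m hm hc.isChain hcov
  obtain ⟨u, v, ⟨k, hk, rfl⟩, hv, huv⟩ := D.exists_adjacent (fun i ↦ ∃ s < m, i = c s)
    ⟨0, hm, rfl⟩ hcov
  push Not at hv
  have h := mt (D.A_eq_zero_iff _ _).mp huv
  by_cases hk2 : 2 * k + 1 ≤ m
  · exact hc.classified_of_near hv hk2 h
  · refine hc.reverse.classified_of_near (v := v) (k := m - 1 - k) (fun s hs ↦ hv _ (by omega))
      (by omega) ?_
    rwa [show m - 1 - (m - 1 - k) = k by omega]

end IsMaxChain

variable (D) in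
/-- The classification of connected Dynkin diagrams of finite type. -/
theorem classified [Nonempty I] : D.Classified := by
  obtain ⟨c, m, hc⟩ := D.exists_isMaxChain
  exact hc.classified

end

section

variable {I : Type*} [Fintype I] [DecidableEq I] {D : FiniteCartan I}

variable (D) in
/-- The finite set `R` is the root system with Cartan matrix `D`, in simple root coordinates. -/
structure IsRoots (R : Finset (I → ℤ)) : Prop where
  single_mem : ∀ i, Pi.single i 1 ∈ R
  neg_mem : ∀ x ∈ R, -x ∈ R
  reflect_mem : ∀ x ∈ R, ∀ j, x - D.pair j x • Pi.single j 1 ∈ R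
  induction : ∀ P : (I → ℤ) → Prop, (∀ i, P (Pi.single i 1)) → (∀ x, P x → P (-x)) →
    (∀ x j, P x → P (x - D.pair j x • Pi.single j 1)) → ∀ x ∈ R, P x

/-- There are sufficiently many roots on which a linear functional takes more than half of its
maximal value. -/
def ManyLargeRoots (R : Finset (I → ℤ)) : Prop :=
  ∃ (f : (I → ℤ) →ₗ[ℤ] ℤ) (M : ℤ), (∀ x ∈ R, f x ≤ M) ∧
    R.card + Fintype.card I ≤ 7 * (R.filter fun x ↦ M < 2 * f x).card

/-- Realization of a root system in coordinates. -/
structure Coordinates (D : FiniteCartan I) (n : ℕ) where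
  /-- the coordinates of the simple roots -/
  ψ : I → Fin n → ℤ
  /-- the simple coroots -/
  coroot : I → (Fin n → ℤ) →ₗ[ℤ] ℤ
  A_eq : ∀ i j, D.A i j = coroot j (ψ i)

namespace Coordinates

variable {n : ℕ} (C : D.Coordinates n)

/-- The coordinates of a vector. -/
def Φ : (I → ℤ) →ₗ[ℤ] (Fin n → ℤ) := Fintype.linearCombination ℤ C.ψ

@[simp] lemma Φ_single (i : I) : C.Φ (Pi.single i 1) = C.ψ i := by
  simp [Φ, Fintype.linearCombination_apply_single]

lemma pair_eq (j : I) (x : I → ℤ) : D.pair j x = C.coroot j (C.Φ x) := by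
  rw [pair_apply, Φ, Fintype.linearCombination_apply, map_sum]
  exact Finset.sum_congr rfl fun i _ ↦ by rw [map_smul, C.A_eq, smul_eq_mul, mul_comm]

lemma Φ_injective : Function.Injective C.Φ := by
  rw [injective_iff_map_eq_zero]
  intro x hx
  exact D.eq_zero_of_pair_eq_zero fun p _ ↦ by rw [pair_eq, hx, map_zero]

lemma Φ_reflect (j : I) (x : I → ℤ) : C.Φ (x - D.pair j x • Pi.single j 1) =
    C.Φ x - C.coroot j (C.Φ x) • C.ψ j := by
  rw [map_sub, map_smul, Φ_single, pair_eq]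

/-- The criterion for many large roots in coordinates. -/
lemma manyLargeRoots {R : Finset (I → ℤ)} {κ : Type*} (g : (Fin n → ℤ) →ₗ[ℤ] ℤ) (M : ℤ)
    (hM : ∀ x ∈ R, g (C.Φ x) ≤ M) (P : Finset κ) (G : κ → Fin n → ℤ)
    (hG : Set.InjOn G P) (hGR : ∀ p ∈ P, ∃ x ∈ R, C.Φ x = G p) (hGM : ∀ p ∈ P, M < 2 * g (G p))
    (hcard : R.card + Fintype.card I ≤ 7 * P.card) : ManyLargeRoots R := by
  refine ⟨g ∘ₗ C.Φ, M, hM, hcard.trans (Nat.mul_le_mul_left 7 ?_)⟩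
  classical
  rw [← Finset.card_image_of_injOn hG, ← Finset.card_image_of_injective _ C.Φ_injective]
  refine Finset.card_le_card fun y hy ↦ ?_
  obtain ⟨p, hp, rfl⟩ := Finset.mem_image.mp hy
  obtain ⟨x, hx, hxp⟩ := hGR p hp
  refine Finset.mem_image.mpr ⟨x, Finset.mem_filter.mpr ⟨hx, ?_⟩, hxp⟩
  simpa [hxp] using hGM p hp

/-- Bounding the number of roots in coordinates. -/
lemma card_le {R : Finset (I → ℤ)} {κ : Type*} (P : Finset κ) (G : κ → Fin n → ℤ)
    (h : ∀ x ∈ R, ∃ p ∈ P, C.Φ x = G p) : R.card ≤ P.card := by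
  classical
  rw [← Finset.card_image_of_injective _ C.Φ_injective]
  refine (Finset.card_le_card fun y hy ↦ ?_).trans (Finset.card_image_le (s := P) (f := G))
  obtain ⟨x, hx, rfl⟩ := Finset.mem_image.mp hy
  obtain ⟨p, hp, h⟩ := h x hx
  exact Finset.mem_image.mpr ⟨p, hp, h.symm⟩

end Coordinates

lemma sub_smul_eq_comp_swap {n : ℕ} {a b : Fin n} (hab : a ≠ b) (y : Fin n → ℤ) :
    y - (y a - y b) • (Pi.single a 1 - Pi.single b 1) = y ∘ Equiv.swap a b := by
  ext i
  by_cases ha : i = a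
  · subst ha; simp [hab]
  by_cases hb : i = b
  · subst hb; simp [ha]
  · simp [ha, hb, Equiv.swap_apply_of_ne_of_ne]

/-- Coordinates in which a chain of simple roots consists of differences of consecutive unit
vectors. -/
structure ChainCoordinates (D : FiniteCartan I) (c : ℕ → I) (m : ℕ)
    extends D.Coordinates (m + 1) where
  ψ_chain : ∀ s : Fin m, ψ (c s) = Pi.single s.castSucc 1 - Pi.single s.succ 1
  coroot_chain : ∀ (s : Fin m) (y : Fin (m + 1) → ℤ), coroot (c s) y = y s.castSucc - y s.succ

namespace ChainCoordinates

variable {c : ℕ → I} {m : ℕ} (C : D.ChainCoordinates c m)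

lemma Φ_reflect_chain (s : Fin m) (x : I → ℤ) :
    C.Φ (x - D.pair (c s) x • Pi.single (c s) 1) = C.Φ x ∘ Equiv.swap s.castSucc s.succ := by
  rw [Coordinates.Φ_reflect, C.ψ_chain, C.coroot_chain, sub_smul_eq_comp_swap]
  exact Fin.castSucc_lt_succ.ne

/-- Permuting coordinates preserves roots. -/
lemma exists_comp_perm {R : Finset (I → ℤ)} (hR : D.IsRoots R) (σ : Equiv.Perm (Fin (m + 1)))
    {y : Fin (m + 1) → ℤ} (hy : ∃ x ∈ R, C.Φ x = y) : ∃ x ∈ R, C.Φ x = y ∘ σ := by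
  have hσ : σ ∈ Submonoid.closure (Set.range fun i : Fin m ↦ Equiv.swap i.castSucc i.succ) := by
    rw [Equiv.Perm.mclosure_swap_castSucc_succ]; trivial
  induction hσ using Submonoid.closure_induction generalizing y with
  | mem σ h =>
    obtain ⟨s, rfl⟩ := h
    obtain ⟨x, hx, rfl⟩ := hy
    exact ⟨_, hR.reflect_mem x hx (c s), C.Φ_reflect_chain s x⟩
  | one => simpa using hy
  | mul σ τ _ _ h1 h2 =>
    have := h2 (h1 hy)
    rwa [Function.comp_assoc] at this

end ChainCoordinates

lemma exists_perm_apply_eq {α : Type*} [DecidableEq α] {a b i j : α} (hab : a ≠ b) (hij : i ≠ j) :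
    ∃ σ : Equiv.Perm α, σ i = a ∧ σ j = b := by
  refine ⟨Equiv.swap (Equiv.swap i a j) b * Equiv.swap i a, ?_, by simp⟩
  rw [Equiv.Perm.mul_apply, Equiv.swap_apply_left, Equiv.swap_apply_of_ne_of_ne _ hab]
  intro h
  apply hij
  have := congrArg (Equiv.swap i a) h
  simpa using this

lemma single_comp_perm {α : Type*} [DecidableEq α] (σ : Equiv.Perm α) (i : α) (z : ℤ) :
    (Pi.single (σ i) z : α → ℤ) ∘ σ = Pi.single i z := by
  ext j
  simp [Pi.single_apply]

end

section

variable {I : Type*} [Fintype I] [DecidableEq I] {D : FiniteCartan I} {c : ℕ → I} {m : ℕ}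

/-- A chain together with a further node `v` has coordinates extending those of the chain. -/
lemma exists_chainCoordinates (hc : D.IsChain c m) {v : I} (ψv : Fin (m + 1) → ℤ)
    (lv : (Fin (m + 1) → ℤ) →ₗ[ℤ] ℤ) (hcov : ∀ i, i = v ∨ ∃ s < m, i = c s)
    (h1 : (∀ s < m, v ≠ c s) → ∀ s : Fin m, D.A v (c s) = ψv s.castSucc - ψv s.succ)
    (h2 : (∀ s < m, v ≠ c s) → ∀ s : Fin m,
      D.A (c s) v = lv (Pi.single s.castSucc 1 - Pi.single s.succ 1))
    (h3 : lv ψv = 2) :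
    ∃ C : D.ChainCoordinates c m, (∀ s < m, v ≠ c s) → C.ψ v = ψv ∧ C.coroot v = lv := by
  classical
  set ψ : I → Fin (m + 1) → ℤ := fun i ↦ if h : ∃ s : Fin m, i = c s then
    Pi.single h.choose.castSucc 1 - Pi.single h.choose.succ 1 else ψv with hψ
  set l : I → (Fin (m + 1) → ℤ) →ₗ[ℤ] ℤ := fun i ↦ if h : ∃ s : Fin m, i = c s then
    LinearMap.proj (R := ℤ) (φ := fun _ ↦ ℤ) h.choose.castSucc -
      LinearMap.proj (R := ℤ) (φ := fun _ ↦ ℤ) h.choose.succ else lv with hl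
  have ec (s : Fin m) (h : ∃ t : Fin m, c s = c t) : h.choose = s :=
    Fin.ext (hc.inj h.choose.2 s.2 h.choose_spec.symm)
  have hψc (s : Fin m) : ψ (c s) = Pi.single s.castSucc 1 - Pi.single s.succ 1 := by
    have h : ∃ t : Fin m, c s = c t := ⟨s, rfl⟩
    simp only [hψ, dif_pos h, ec s h]
  have hlc (s : Fin m) (y : Fin (m + 1) → ℤ) : l (c s) y = y s.castSucc - y s.succ := by
    have h : ∃ t : Fin m, c s = c t := ⟨s, rfl⟩
    simp only [hl, dif_pos h, ec s h]
    rfl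
  have hv (h : ∀ s < m, v ≠ c s) : ψ v = ψv ∧ l v = lv := by
    have h' : ¬ ∃ t : Fin m, v = c t := fun ⟨t, ht⟩ ↦ h t t.2 ht
    simp only [hψ, hl, dif_neg h', and_self]
  have hcases (i : I) : (∃ s : Fin m, i = c s) ∨ (i = v ∧ ∀ s < m, v ≠ c s) := by
    by_cases h : ∃ s : Fin m, i = c s
    · exact Or.inl h
    · obtain rfl | ⟨s, hs, rfl⟩ := hcov i
      · exact Or.inr ⟨rfl, fun s hs hvs ↦ h ⟨⟨s, hs⟩, hvs⟩⟩
      · exact (h ⟨⟨s, hs⟩, rfl⟩).elim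
  refine ⟨⟨⟨ψ, l, fun i j ↦ ?_⟩, hψc, hlc⟩, hv⟩
  rcases hcases i with ⟨s, rfl⟩ | ⟨rfl, hi⟩ <;> rcases hcases j with ⟨t, rfl⟩ | ⟨rfl, hj⟩
  · rw [hlc, hψc, hc _ s.2 _ t.2]
    simp only [Pi.sub_apply, Pi.single_apply, Fin.ext_iff, Fin.val_castSucc, Fin.val_succ]
    split_ifs <;> omega
  · rw [(hv hj).2, hψc, h2 hj]
  · rw [(hv hi).1, hlc, h1 hi]
  · rw [(hv hi).1, (hv hi).2, D.A_self, h3]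

lemma card_le_of_cover {v : I} (hcov : ∀ i, i = v ∨ ∃ s < m, i = c s) :
    Fintype.card I ≤ m + 1 := by
  classical
  have : (Finset.univ : Finset I) ⊆ insert v ((Finset.range m).image c) := by
    intro i _
    rcases hcov i with rfl | ⟨s, hs, rfl⟩
    · simp
    · simp only [Finset.mem_insert, Finset.mem_image, Finset.mem_range]
      exact Or.inr ⟨s, hs, rfl⟩
  calc Fintype.card I ≤ (insert v ((Finset.range m).image c)).card := Finset.card_le_card this
    _ ≤ ((Finset.range m).image c).card + 1 := Finset.card_insert_le _ _
    _ ≤ m + 1 := by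
      have := Finset.card_image_le (s := Finset.range m) (f := c)
      simp at this; omega

/-- Root systems of type `A`. -/
lemma manyLargeRoots_A {R : Finset (I → ℤ)} (hR : D.IsRoots R) (hm : 0 < m) (hc : D.IsChain c m)
    (hcov : ∀ i, ∃ s < m, i = c s) : ManyLargeRoots R := by
  classical
  obtain ⟨C, -⟩ := exists_chainCoordinates hc (v := c 0) (Pi.single 0 1)
    ((2 : ℤ) • LinearMap.proj 0) (fun i ↦ Or.inr (hcov i)) (fun h ↦ (h 0 hm rfl).elim)
    (fun h ↦ (h 0 hm rfl).elim) (by simp)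
  have hQ : ∀ x ∈ R, ∃ i j, i ≠ j ∧ C.Φ x = Pi.single i 1 - Pi.single j 1 := by
    refine hR.induction _ (fun i ↦ ?_) (fun x ↦ ?_) (fun x j ↦ ?_)
    · obtain ⟨s, hs, rfl⟩ := hcov i
      exact ⟨_, _, Fin.castSucc_lt_succ.ne, by rw [C.Φ_single]; exact C.ψ_chain ⟨s, hs⟩⟩
    · rintro ⟨i, j, hij, h⟩
      exact ⟨j, i, hij.symm, by rw [map_neg, h, neg_sub]⟩
    · rintro ⟨a, b, hab, h⟩
      obtain ⟨s, hs, rfl⟩ := hcov j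
      have h1 := C.Φ_reflect_chain ⟨s, hs⟩ x
      rw [h] at h1
      set σ := Equiv.swap (Fin.castSucc ⟨s, hs⟩) (Fin.succ ⟨s, hs⟩)
      refine ⟨σ.symm a, σ.symm b, by simpa using hab, h1.trans ?_⟩
      rw [← single_comp_perm σ (σ.symm a), ← single_comp_perm σ (σ.symm b),
        Equiv.apply_symm_apply, Equiv.apply_symm_apply]
      rfl
  have hex (i j : Fin (m + 1)) (hij : i ≠ j) :
      ∃ x ∈ R, C.Φ x = Pi.single i 1 - Pi.single j 1 := by
    have h0 : ∃ x ∈ R, C.Φ x = Pi.single (Fin.castSucc ⟨0, hm⟩) 1 - Pi.single (Fin.succ ⟨0, hm⟩) 1 :=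
      ⟨_, hR.single_mem (c 0), by rw [C.Φ_single]; exact C.ψ_chain ⟨0, hm⟩⟩
    obtain ⟨σ, h1, h2⟩ := exists_perm_apply_eq
      (Fin.castSucc_lt_succ (i := (⟨0, hm⟩ : Fin m))).ne hij
    obtain ⟨x, hx, h3⟩ := C.exists_comp_perm hR σ h0
    refine ⟨x, hx, h3.trans ?_⟩
    rw [← single_comp_perm σ i, ← single_comp_perm σ j, h1, h2]
    rfl
  have hcR : R.card ≤ (m + 1) * m := by
    refine (C.card_le (Finset.univ.offDiag) (fun p ↦ Pi.single p.1 1 - Pi.single p.2 1)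
      fun x hx ↦ ?_).trans (by simp [Finset.offDiag_card, Nat.mul_succ, Nat.succ_mul])
    obtain ⟨i, j, hij, h⟩ := hQ x hx
    exact ⟨(i, j), by simpa using hij, h⟩
  have hcI : Fintype.card I ≤ m := by
    have : (Finset.univ : Finset I) ⊆ (Finset.range m).image c := fun i _ ↦ by
      obtain ⟨s, hs, rfl⟩ := hcov i
      exact Finset.mem_image_of_mem _ (by simpa using hs)
    have := (Finset.card_le_card this).trans Finset.card_image_le
    simpa using this
  set k : Fin (m + 1) := ⟨(m + 1) / 2, by omega⟩ with hk
  have hgs (i : Fin (m + 1)) : (∑ t ∈ Finset.Iio k, LinearMap.proj t :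
      (Fin (m + 1) → ℤ) →ₗ[ℤ] ℤ) (Pi.single i 1) = if i < k then 1 else 0 := by
    simp [LinearMap.sum_apply, Pi.single_apply]
  refine C.manyLargeRoots (∑ t ∈ Finset.Iio k, LinearMap.proj t) 1 (fun x hx ↦ ?_)
    (Finset.Iio k ×ˢ Finset.Ici k) (fun p ↦ Pi.single p.1 1 - Pi.single p.2 1) ?_ ?_ ?_ ?_
  · obtain ⟨i, j, hij, h⟩ := hQ x hx
    rw [h, map_sub, hgs, hgs]
    split_ifs <;> norm_num
  · rintro ⟨a, b⟩ hab ⟨a', b'⟩ hab' h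
    simp only [Finset.coe_product, Finset.coe_Iio, Finset.coe_Ici, Set.mem_prod, Set.mem_Iio,
      Set.mem_Ici] at hab hab' h
    have e1 := congrFun h a
    have e2 := congrFun h b
    simp only [Pi.sub_apply, Pi.single_apply] at e1 e2
    have : a ≠ b := (hab.1.trans_le hab.2).ne
    have : a ≠ b' := (hab.1.trans_le hab'.2).ne
    have : b ≠ a' := (hab'.1.trans_le hab.2).ne'
    have : a = a' := by by_contra hh; simp_all
    have : b = b' := by by_contra hh; simp_all
    simp_all
  · rintro ⟨a, b⟩ hab
    simp only [Finset.mem_product, Finset.mem_Iio, Finset.mem_Ici] at hab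
    exact hex a b (hab.1.trans_le hab.2).ne
  · rintro ⟨a, b⟩ hab
    simp only [Finset.mem_product, Finset.mem_Iio, Finset.mem_Ici] at hab
    rw [map_sub, hgs, hgs, if_pos hab.1, if_neg hab.2.not_gt]
    norm_num
  · rw [Finset.card_product, Fin.card_Iio, Fin.card_Ici]
    obtain ⟨t, ht | ht⟩ : ∃ t, m + 1 = 2 * t ∨ m + 1 = 2 * t + 1 := ⟨(m + 1) / 2, by omega⟩
    · have h1 : (m + 1) / 2 = t := by omega
      have h2 : m + 1 - t = t := by omega
      simp only [hk, h1, h2]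
      obtain rfl : m = 2 * t - 1 := by omega
      obtain ⟨t, rfl⟩ : ∃ u, t = u + 1 := ⟨t - 1, by omega⟩
      have : 2 * (t + 1) - 1 = 2 * t + 1 := by omega
      rw [this] at hcR hcI
      nlinarith
    · have h1 : (m + 1) / 2 = t := by omega
      have h2 : m + 1 - t = t + 1 := by omega
      simp only [hk, h1, h2]
      obtain rfl : m = 2 * t := by omega
      nlinarith

/-- The vectors occurring as roots of type `B`, `C` and `D`. -/
def IsSigned {n : ℕ} (q : ℤ) (y : Fin n → ℤ) : Prop :=
  (∃ (i : Fin n) (a : ℤˣ), y = Pi.single i (a * q)) ∨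
    ∃ (i j : Fin n) (a b : ℤˣ), i ≠ j ∧ y = Pi.single i (a : ℤ) + Pi.single j (b : ℤ)

lemma single_signed {n : ℕ} (ε : Fin n → ℤˣ) (σ : Equiv.Perm (Fin n)) (i : Fin n) (z : ℤ) :
    (fun j ↦ (ε j : ℤ) * (Pi.single i z : Fin n → ℤ) (σ j)) =
      Pi.single (σ.symm i) (ε (σ.symm i) * z) := by
  ext j
  by_cases h : j = σ.symm i
  · subst h; simp
  · have : σ j ≠ i := fun h' ↦ h (by simp [← h'])
    simp [this, h]

lemma IsSigned.signed {n : ℕ} {q : ℤ} {y : Fin n → ℤ} (hy : IsSigned q y) (ε : Fin n → ℤˣ)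
    (σ : Equiv.Perm (Fin n)) : IsSigned q fun j ↦ (ε j : ℤ) * y (σ j) := by
  rcases hy with ⟨i, a, rfl⟩ | ⟨i, j, a, b, hij, rfl⟩
  · refine Or.inl ⟨σ.symm i, ε (σ.symm i) * a, ?_⟩
    rw [single_signed]; push_cast; rw [mul_assoc]
  · refine Or.inr ⟨σ.symm i, σ.symm j, ε (σ.symm i) * a, ε (σ.symm j) * b, by simpa using hij, ?_⟩
    push_cast
    rw [← single_signed, ← single_signed]
    ext t
    simp [mul_add]

/-- A parametrization of the signed vectors. -/
def signedVector {n : ℕ} (q : ℤ) (p : Fin n × Fin n × ℤˣ) : Fin n → ℤ :=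
  if p.1 = p.2.1 then Pi.single p.1 (p.2.2 * q)
  else if p.1 < p.2.1 then Pi.single p.1 (p.2.2 : ℤ) + Pi.single p.2.1 (p.2.2 : ℤ)
  else Pi.single p.1 (p.2.2 : ℤ) + Pi.single p.2.1 (-p.2.2 : ℤ)

lemma IsSigned.exists_eq {n : ℕ} {q : ℤ} {y : Fin n → ℤ} (hy : IsSigned q y) :
    ∃ p, y = signedVector q p := by
  rcases hy with ⟨i, a, rfl⟩ | ⟨i, j, a, b, hij, rfl⟩
  · exact ⟨(i, i, a), by simp [signedVector]⟩
  · wlog h : i < j generalizing i j a b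
    · obtain ⟨p, hp⟩ := this j i b a hij.symm (lt_of_le_of_ne (not_lt.mp h) hij.symm)
      exact ⟨p, by rw [← hp, add_comm]⟩
    · by_cases hab : a = b
      · subst hab
        exact ⟨(i, j, a), by simp [signedVector, hij, h]⟩
      · have hab : a = -b := by
          rcases Int.units_eq_one_or a with rfl | rfl <;>
            rcases Int.units_eq_one_or b with rfl | rfl <;> simp_all
        subst hab
        exact ⟨(j, i, b), by simp [signedVector, hij.symm, h.not_gt, add_comm]⟩

lemma pair_vector_injOn {n : ℕ} : Set.InjOn (fun p : (_ : Fin n) × Fin n ↦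
    (Pi.single p.1 1 + Pi.single p.2 1 : Fin n → ℤ)) {p | p.2 ≤ p.1} := by
  rintro ⟨a, b⟩ hab ⟨a', b'⟩ hab' h
  have key (w : Fin n → ℤ) : w a + w b = w a' + w b' := by
    simpa [mul_add, Finset.sum_add_distrib, Pi.single_apply] using
      congrArg (fun y : Fin n → ℤ ↦ ∑ t, w t * y t) h
  have h1 := key fun t ↦ (t : ℤ)
  have h2 := key fun t ↦ (t : ℤ) ^ 2
  have hab : (b : ℤ) ≤ a := by exact_mod_cast hab
  have hab' : (b' : ℤ) ≤ a' := by exact_mod_cast hab'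
  have h3 : (a : ℤ) - b = a' - b' := by
    rw [← abs_of_nonneg (sub_nonneg.mpr hab), ← abs_of_nonneg (sub_nonneg.mpr hab'),
      ← sq_eq_sq_iff_abs_eq_abs]
    linear_combination 2 * h2 - (a + b + a' + b' : ℤ) * h1
  obtain rfl : a = a' := Fin.ext (by omega)
  obtain rfl : b = b' := Fin.ext (by omega)
  rfl

end

section

variable {I : Type*} [Fintype I] [DecidableEq I] {D : FiniteCartan I} {c : ℕ → I} {m : ℕ}

omit [Fintype I] [DecidableEq I] in
lemma chain_or_node {v : I} (hcov : ∀ i, i = v ∨ ∃ s < m, i = c s) (i : I) :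
    (∃ s : Fin m, i = c s) ∨ i = v := by
  rcases hcov i with h | ⟨s, hs, h⟩
  · exact Or.inr h
  · exact Or.inl ⟨⟨s, hs⟩, h⟩

namespace ChainCoordinates

variable (C : D.ChainCoordinates c m) {R : Finset (I → ℤ)} (hR : D.IsRoots R) {v : I}
  (hcov : ∀ i, i = v ∨ ∃ s < m, i = c s)
include hR hcov

lemma isSigned {q : ℤ} (hψ : IsSigned q (C.ψ v))
    (hrefl : ∀ y, ∃ (ε : Fin (m + 1) → ℤˣ) (σ : Equiv.Perm (Fin (m + 1))),
      y - C.coroot v y • C.ψ v = fun j ↦ (ε j : ℤ) * y (σ j)) :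
    ∀ x ∈ R, IsSigned q (C.Φ x) := by
  refine hR.induction _ (fun i ↦ ?_) (fun x hx ↦ ?_) (fun x j hx ↦ ?_)
  · rw [C.Φ_single]
    rcases chain_or_node hcov i with ⟨s, rfl⟩ | rfl
    · refine Or.inr ⟨s.castSucc, s.succ, 1, -1, Fin.castSucc_lt_succ.ne, (C.ψ_chain s).trans ?_⟩
      rw [sub_eq_add_neg, ← Pi.single_neg]
      simp
    · exact hψ
  · convert hx.signed (fun _ ↦ -1) 1 using 1
    ext j
    simp
  · rcases chain_or_node hcov j with ⟨s, rfl⟩ | rfl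
    · rw [C.Φ_reflect_chain]
      convert hx.signed (fun _ ↦ 1) (Equiv.swap s.castSucc s.succ) using 1
      ext j
      simp
    · rw [C.Φ_reflect]
      obtain ⟨ε, σ, h⟩ := hrefl (C.Φ x)
      rw [h]
      exact hx.signed ε σ

/-- The common part of the argument for the root systems of type `B`, `C` and `D`. -/
lemma manyLargeRoots_of_isSigned {q : ℤ} (hq : |q| ≤ 2) (hQ : ∀ x ∈ R, IsSigned q (C.Φ x))
    {a b : Fin (m + 1)} (hab : a ≠ b)
    (h : ∃ x ∈ R, C.Φ x = Pi.single a 1 + Pi.single b 1)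
    (h' : 2 ≤ m ∨ ∃ i, ∃ x ∈ R, C.Φ x = Pi.single i 2) : ManyLargeRoots R := by
  classical
  have hq := abs_le.mp hq
  have hcR : R.card ≤ (m + 1) * ((m + 1) * 2) := by
    refine (C.card_le (Finset.univ) (signedVector q) fun x hx ↦ ?_).trans
      (by simp [Fintype.card_units_int])
    obtain ⟨p, hp⟩ := (hQ x hx).exists_eq
    exact ⟨p, Finset.mem_univ _, hp⟩
  have hcI := card_le_of_cover hcov
  have hgs (i : Fin (m + 1)) (z : ℤ) : (∑ t, LinearMap.proj t :
      (Fin (m + 1) → ℤ) →ₗ[ℤ] ℤ) (Pi.single i z) = z := by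
    simp [LinearMap.sum_apply]
  have hM : ∀ x ∈ R, (∑ t, LinearMap.proj t : (Fin (m + 1) → ℤ) →ₗ[ℤ] ℤ) (C.Φ x) ≤ 2 := by
    intro x hx
    rcases hQ x hx with ⟨i, e, h⟩ | ⟨i, j, e, e', -, h⟩
    · rw [h, hgs]
      rcases Int.units_eq_one_or e with rfl | rfl <;> simp <;> omega
    · rw [h, map_add, hgs, hgs]
      rcases Int.units_eq_one_or e with rfl | rfl <;>
        rcases Int.units_eq_one_or e' with rfl | rfl <;> simp
  have hex (i j : Fin (m + 1)) (hij : i ≠ j) :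
      ∃ x ∈ R, C.Φ x = Pi.single i 1 + Pi.single j 1 := by
    obtain ⟨σ, h1, h2⟩ := exists_perm_apply_eq hab hij
    obtain ⟨x, hx, h3⟩ := C.exists_comp_perm hR σ h
    refine ⟨x, hx, h3.trans ?_⟩
    rw [← single_comp_perm σ i, ← single_comp_perm σ j, h1, h2]
    rfl
  have hgauss := Finset.sum_range_id_mul_two (m + 1)
  rcases h' with hm | ⟨i₀, h2⟩
  · refine C.manyLargeRoots _ 2 hM (Finset.univ.sigma fun j ↦ Finset.Iio j)
      (fun p ↦ Pi.single p.1 1 + Pi.single p.2 1) (pair_vector_injOn.mono ?_) ?_ ?_ ?_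
    · rintro ⟨i, j⟩ hij
      exact (show j < i by simpa using hij).le
    · rintro ⟨i, j⟩ hij
      exact hex i j (show j < i by simpa using hij).ne'
    · rintro ⟨i, j⟩ -
      rw [map_add, hgs, hgs]; norm_num
    · rw [Finset.card_sigma]
      simp only [Fin.card_Iio]
      rw [← Finset.sum_range (fun i ↦ i)]
      simp only [Nat.add_sub_cancel] at hgauss
      nlinarith
  · refine C.manyLargeRoots _ 2 hM (Finset.univ.sigma fun j ↦ Finset.Iic j)
      (fun p ↦ Pi.single p.1 1 + Pi.single p.2 1) (pair_vector_injOn.mono ?_) ?_ ?_ ?_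
    · rintro ⟨i, j⟩ hij
      exact show j ≤ i by simpa using hij
    · rintro ⟨i, j⟩ hij
      by_cases h : i = j
      · subst h
        obtain ⟨x, hx, h3⟩ := C.exists_comp_perm hR (Equiv.swap i i₀) h2
        refine ⟨x, hx, h3.trans ?_⟩
        rw [← Pi.single_add, ← single_comp_perm (Equiv.swap i i₀) i, Equiv.swap_apply_left]
        rfl
      · exact hex i j h
    · rintro ⟨i, j⟩ -
      rw [map_add, hgs, hgs]; norm_num
    · rw [Finset.card_sigma]
      simp only [Fin.card_Iic]
      rw [Finset.sum_add_distrib, ← Finset.sum_range (fun i ↦ i)]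
      simp only [Nat.add_sub_cancel] at hgauss
      simp only [Finset.sum_const, Finset.card_univ, Fintype.card_fin, smul_eq_mul, mul_one]
      nlinarith

end ChainCoordinates

lemma Attached.ne {v : I} {k : ℕ} {a b : ℤ} (hv : D.Attached c m v k a b) (ha : a < 0) :
    ∀ s < m, v ≠ c s := by
  rintro s hs rfl
  by_cases h : s = k
  · subst h
    have := hv.left
    rw [D.A_self] at this
    omega
  · have := hv.left_of_ne s hs h
    rw [D.A_self] at this
    omega

variable {R : Finset (I → ℤ)} (hR : D.IsRoots R) {v : I}
  (hcov : ∀ i, i = v ∨ ∃ s < m, i = c s) (hc : D.IsChain c m)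
include hR hcov hc

/-- Root systems of type `B` and `C`. -/
lemma manyLargeRoots_BC {q r : ℤ} (hqr : q = 1 ∧ r = 2 ∧ 2 ≤ m ∨ q = 2 ∧ r = 1 ∧ 1 ≤ m)
    (hv : D.Attached c m v (m - 1) (-q) (-r)) (hne : ∀ s < m, v ≠ c s) : ManyLargeRoots R := by
  have hm : m - 1 < m := by omega
  obtain ⟨C, hC⟩ := exists_chainCoordinates hc (v := v) (Pi.single (Fin.last m) q)
    (r • LinearMap.proj (Fin.last m)) hcov (fun _ s ↦ by
      by_cases hs : (s : ℕ) = m - 1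
      · obtain rfl : s = ⟨m - 1, hm⟩ := Fin.ext hs
        have h1 : Fin.succ ⟨m - 1, hm⟩ = Fin.last m := Fin.ext (by simp; omega)
        rw [hv.left, h1]
        simp [Pi.single_apply, Fin.ext_iff]; omega
      · rw [hv.left_of_ne s s.2 hs]
        simp only [Pi.single_apply, Fin.ext_iff]
        rw [if_neg (by simp; omega), if_neg (by simp; omega)]; simp) (fun _ s ↦ by
      by_cases hs : (s : ℕ) = m - 1
      · obtain rfl : s = ⟨m - 1, hm⟩ := Fin.ext hs
        have h1 : Fin.succ ⟨m - 1, hm⟩ = Fin.last m := Fin.ext (by simp; omega)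
        rw [hv.right, h1]
        have h2 : Fin.castSucc ⟨m - 1, hm⟩ ≠ Fin.last m := Fin.ne_of_val_ne (by simp; omega)
        rw [LinearMap.smul_apply, LinearMap.proj_apply, Pi.sub_apply, Pi.single_eq_of_ne h2.symm,
          Pi.single_eq_same, smul_eq_mul]
        ring
      · rw [hv.right_of_ne s s.2 hs]
        simp only [LinearMap.smul_apply, LinearMap.proj_apply, Pi.sub_apply, Pi.single_apply,
          Fin.ext_iff]
        rw [if_neg (by simp; omega), if_neg (by simp; omega)]; simp)
      (by rcases hqr with ⟨rfl, rfl, -⟩ | ⟨rfl, rfl, -⟩ <;> simp)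
  obtain ⟨hψ, hl⟩ := hC hne
  have hrefl (y : Fin (m + 1) → ℤ) : y - C.coroot v y • C.ψ v =
      fun j ↦ ((if j = Fin.last m then -1 else 1 : ℤˣ) : ℤ) * y j := by
    rw [hψ, hl]
    ext j
    by_cases hj : j = Fin.last m
    · subst hj
      rcases hqr with ⟨rfl, rfl, -⟩ | ⟨rfl, rfl, -⟩ <;> simp <;> ring
    · simp [hj]
  refine C.manyLargeRoots_of_isSigned (q := q) hR hcov ?_ (C.isSigned hR hcov ?_ ?_)
    (a := Fin.castSucc ⟨m - 1, hm⟩) (b := Fin.succ ⟨m - 1, hm⟩) Fin.castSucc_lt_succ.ne ?_ ?_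
  · rcases hqr with ⟨rfl, -⟩ | ⟨rfl, -⟩ <;> norm_num
  · exact Or.inl ⟨Fin.last m, 1, by rw [hψ]; simp⟩
  · exact fun y ↦ ⟨_, 1, hrefl y⟩
  · refine ⟨_, hR.reflect_mem _ (hR.single_mem (c (m - 1))) v, ?_⟩
    rw [C.Φ_reflect, hrefl, C.Φ_single, C.ψ_chain ⟨m - 1, hm⟩]
    have h1 : Fin.succ ⟨m - 1, hm⟩ = Fin.last m := Fin.ext (by simp; omega)
    have h2 : Fin.castSucc ⟨m - 1, hm⟩ ≠ Fin.last m := Fin.ne_of_val_ne (by simp; omega)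
    rw [h1]
    ext j
    by_cases hj : j = Fin.last m
    · subst hj
      rw [Pi.sub_apply, Pi.add_apply, Pi.single_eq_of_ne h2.symm, Pi.single_eq_same]
      simp
    · rw [Pi.sub_apply, Pi.add_apply, Pi.single_eq_of_ne hj]
      simp [hj]
  · rcases hqr with ⟨rfl, -, hm⟩ | ⟨rfl, -, -⟩
    · exact Or.inl hm
    · exact Or.inr ⟨_, _, hR.single_mem v, by rw [C.Φ_single, hψ]⟩

/-- Root systems of type `D`. -/
lemma manyLargeRoots_D (hm3 : 3 ≤ m) (hv : D.Attached c m v (m - 2) (-1) (-1))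
    (hne : ∀ s < m, v ≠ c s) : ManyLargeRoots R := by
  have hm : m - 1 < m := by omega
  set a : Fin (m + 1) := ⟨m - 1, by omega⟩ with ha
  set b : Fin (m + 1) := Fin.last m with hb
  have hab : a ≠ b := Fin.ne_of_val_ne (by simp [ha, hb]; omega)
  have key (s : Fin m) : (if (s : ℕ) = m - 2 then (-1 : ℤ) else 0) =
      (Pi.single a 1 + Pi.single b 1 : Fin (m + 1) → ℤ) s.castSucc -
      (Pi.single a 1 + Pi.single b 1 : Fin (m + 1) → ℤ) s.succ := by
    simp only [Pi.add_apply, Pi.single_apply, Fin.ext_iff, ha, hb, Fin.val_last, Fin.val_castSucc,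
      Fin.val_succ]
    split_ifs <;> omega
  obtain ⟨l, hl'⟩ : ∃ l : (Fin (m + 1) → ℤ) →ₗ[ℤ] ℤ, ∀ y, l y = y a + y b :=
    ⟨LinearMap.proj (R := ℤ) (φ := fun _ ↦ ℤ) a + LinearMap.proj (R := ℤ) (φ := fun _ ↦ ℤ) b,
      fun _ ↦ rfl⟩
  obtain ⟨C, hC⟩ := exists_chainCoordinates hc (v := v) (Pi.single a 1 + Pi.single b 1) l hcov (fun _ s ↦ by
      rw [← key]
      split_ifs with hs
      · rw [hs, hv.left]
      · exact hv.left_of_ne s s.2 hs) (fun _ s ↦ by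
      have : D.A (c s) v = if (s : ℕ) = m - 2 then (-1 : ℤ) else 0 := by
        split_ifs with hs
        · rw [hs, hv.right]
        · exact hv.right_of_ne s s.2 hs
      rw [this, key]
      simp only [hl', Pi.sub_apply, Pi.add_apply, Pi.single_apply]
      simp only [eq_comm (a := a), eq_comm (a := b)]
      ring)
      (by simp [hl', hab, hab.symm])
  obtain ⟨hψ, hl⟩ := hC hne
  have hrefl (y : Fin (m + 1) → ℤ) : y - C.coroot v y • C.ψ v =
      fun j ↦ ((if j = a ∨ j = b then -1 else 1 : ℤˣ) : ℤ) * y (Equiv.swap a b j) := by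
    rw [hψ, hl, hl']
    ext j
    by_cases hja : j = a
    · subst hja; simp [hab]
    by_cases hjb : j = b
    · rw [hjb]; simp [hab.symm]
    · simp [hja, hjb, Equiv.swap_apply_of_ne_of_ne]
  refine C.manyLargeRoots_of_isSigned (q := 1) hR hcov (by norm_num) (C.isSigned hR hcov ?_ ?_)
    hab ⟨_, hR.single_mem v, by rw [C.Φ_single, hψ]⟩ (Or.inl (by omega))
  · exact Or.inr ⟨a, b, 1, 1, hab, by rw [hψ]; simp⟩
  · exact fun y ↦ ⟨_, _, hrefl y⟩

end

section

/-- The positive roots of type `E₆`. -/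
def rootsE₆ : List ℕ :=
  [1, 10, 11, 100, 110, 111, 1000, 1100, 1110, 1111, 10000, 11000, 11100, 11110, 11111, 100000,
   100100, 100110, 100111, 101100, 101110, 101111, 101210, 101211, 101221, 111100, 111110, 111111,
   111210, 111211, 111221, 112210, 112211, 112221, 112321, 212321]

/-- The positive roots of type `E₇`. -/
def rootsE₇ : List ℕ :=
  [1, 10, 11, 100, 110, 111, 1000, 1100, 1110, 1111, 10000, 11000, 11100, 11110, 11111, 100000,
   110000, 111000, 111100, 111110, 111111, 1000000, 1000100, 1000110, 1000111, 1001100, 1001110,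
   1001111, 1001210, 1001211, 1001221, 1011100, 1011110, 1011111, 1011210, 1011211, 1011221,
   1012210, 1012211, 1012221, 1012321, 1111100, 1111110, 1111111, 1111210, 1111211, 1111221,
   1112210, 1112211, 1112221, 1112321, 1122210, 1122211, 1122221, 1122321, 1123321, 2012321,
   2112321, 2122321, 2123321, 2123421, 2123431, 2123432]

/-- The positive roots of type `E₈`. -/
def rootsE₈ : List ℕ :=
  [1, 10, 11, 100, 110, 111, 1000, 1100, 1110, 1111, 10000, 11000, 11100, 11110, 11111, 100000,
   110000, 111000, 111100, 111110, 111111, 1000000, 1100000, 1110000, 1111000, 1111100, 1111110,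
   1111111, 10000000, 10000100, 10000110, 10000111, 10001100, 10001110, 10001111, 10001210,
   10001211, 10001221, 10011100, 10011110, 10011111, 10011210, 10011211, 10011221, 10012210,
   10012211, 10012221, 10012321, 10111100, 10111110, 10111111, 10111210, 10111211, 10111221,
   10112210, 10112211, 10112221, 10112321, 10122210, 10122211, 10122221, 10122321, 10123321,
   11111100, 11111110, 11111111, 11111210, 11111211, 11111221, 11112210, 11112211, 11112221,
   11112321, 11122210, 11122211, 11122221, 11122321, 11123321, 11222210, 11222211, 11222221,
   11222321, 11223321, 11233321, 20012321, 20112321, 20122321, 20123321, 20123421, 20123431,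
   20123432, 21112321, 21122321, 21123321, 21123421, 21123431, 21123432, 21222321, 21223321,
   21223421, 21223431, 21223432, 21233321, 21233421, 21233431, 21233432, 21234421, 21234431,
   21234432, 21234531, 21234532, 21234542, 31234531, 31234532, 31234542, 31234642, 31235642,
   31245642, 31345642, 32345642]

/-- The positive roots of type `F₄`. -/
def rootsF₄ : List ℕ :=
  [1, 10, 11, 100, 110, 111, 210, 211, 221, 1000, 1100, 1110, 1111, 1210, 1211, 1221, 1321, 2210,
   2211, 2221, 2321, 2421, 2431, 2432]

/-- The positive roots of type `G₂`. -/
def rootsG₂ : List ℕ :=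
  [1, 10, 11, 12, 13, 23]

/-- The coefficient of the simple root with label `i` in the root with code `v`. -/
def digit (v i : ℕ) : ℕ := v / 10 ^ i % 10

/-- The value at the root with code `v` of the linear functional with values `g`. -/
def codeEval (N : ℕ) (g : ℕ → ℤ) (v : ℕ) : ℤ := ((List.range N).map fun i ↦ g i * digit v i).sum

/-- The code of the reflection of the root with code `v`. -/
def codeReflect (M : ℕ → ℕ → ℤ) (N j v : ℕ) : ℕ :=
  ((v : ℤ) - codeEval N (M · j) v * 10 ^ j).toNat

/-- The list `T` is the list of codes of the positive roots with Cartan matrix `M`. -/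
structure IsTable (M : ℕ → ℕ → ℤ) (N : ℕ) (T : List ℕ) : Prop where
  nodup : T.Nodup
  sum_digits : ∀ v ∈ T, ((List.range N).map fun i ↦ digit v i * 10 ^ i).sum = v
  simple : ∀ j < N, 10 ^ j ∈ T ∧ ∀ i < N, digit (10 ^ j) i = if i = j then 1 else 0
  reflect : ∀ v ∈ T, ∀ j < N, codeEval N (M · j) v = 0 ∨ v = 10 ^ j ∨ codeReflect M N j v ∈ T ∧
    ∀ i < N, (digit (codeReflect M N j v) i : ℤ) =
      digit v i - if i = j then codeEval N (M · j) v else 0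
  descent : ∀ v ∈ T, ∃ j < N, v = 10 ^ j ∨ codeReflect M N j v < v

variable {M : ℕ → ℕ → ℤ} {N : ℕ} {T : List ℕ}

lemma isTable_E₆ : IsTable (matrixE 5) 6 rootsE₆ := by constructor <;> decide +kernel
lemma isTable_E₇ : IsTable (matrixE 6) 7 rootsE₇ := by constructor <;> decide +kernel
lemma isTable_E₈ : IsTable (matrixE 7) 8 rootsE₈ := by constructor <;> decide +kernel
lemma isTable_F₄ : IsTable matrixF 4 rootsF₄ := by constructor <;> decide +kernel
lemma isTable_G₂ : IsTable matrixG 2 rootsG₂ := by constructor <;> decide +kernel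

end

section

variable {I : Type*} [Fintype I] [DecidableEq I] {D : FiniteCartan I}
  {M : ℕ → ℕ → ℤ} {N : ℕ} {T : List ℕ}

/-- The root with code `v`. -/
def decode (e : Fin N ≃ I) (v : ℕ) (i : I) : ℤ := digit v (e.symm i)

omit [DecidableEq I] in
lemma sum_mul_decode (e : Fin N ≃ I) (g : ℕ → ℤ) (v : ℕ) :
    ∑ i, g (e.symm i) * decode e v i = codeEval N g v := by
  rw [← e.sum_comp]
  simp only [decode, Equiv.symm_apply_apply]
  exact (Finset.sum_range fun i ↦ g i * (digit v i : ℤ)).symm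

lemma pair_decode {e : Fin N ≃ I} (he : ∀ a b : Fin N, D.A (e a) (e b) = M a b) (j : Fin N)
    (v : ℕ) : D.pair (e j) (decode e v) = codeEval N (M · j) v := by
  rw [← sum_mul_decode e, pair_apply]
  refine Finset.sum_congr rfl fun i _ ↦ ?_
  rw [← he, Equiv.apply_symm_apply]

namespace IsTable

variable (hT : IsTable M N T)
include hT

omit [Fintype I] in
lemma decode_simple (e : Fin N ≃ I) (j : Fin N) : decode e (10 ^ (j : ℕ)) = Pi.single (e j) 1 := by
  ext i
  rw [decode, (hT.simple j j.2).2 _ (e.symm i).2, Pi.single_apply]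
  simp only [← Fin.ext_iff, Equiv.symm_apply_eq]
  split_ifs <;> rfl

lemma decode_reflect {e : Fin N ≃ I} (he : ∀ a b : Fin N, D.A (e a) (e b) = M a b) {v : ℕ}
    (hv : v ∈ T) (j : Fin N) : D.pair (e j) (decode e v) = 0 ∨ v = 10 ^ (j : ℕ) ∨
      codeReflect M N j v ∈ T ∧ decode e (codeReflect M N j v) =
        decode e v - D.pair (e j) (decode e v) • Pi.single (e j) 1 := by
  rw [pair_decode he]
  refine (hT.reflect v hv j j.2).imp_right (Or.imp_right fun h ↦ ⟨h.1, ?_⟩)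
  ext i
  rw [decode, h.2 _ (e.symm i).2, Pi.sub_apply, Pi.smul_apply, Pi.single_apply, decode]
  simp only [← Fin.ext_iff, Equiv.symm_apply_eq]
  split_ifs <;> simp

omit [Fintype I] [DecidableEq I] in
lemma decode_injOn (e : Fin N ≃ I) : Set.InjOn (decode e) {v | v ∈ T} := by
  intro v hv w hw h
  rw [← hT.sum_digits v hv, ← hT.sum_digits w hw]
  congr 1
  refine List.map_congr_left fun i hi ↦ ?_
  have := congrFun h (e ⟨i, List.mem_range.mp hi⟩)
  simp only [decode, Equiv.symm_apply_apply, Nat.cast_inj] at this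
  rw [this]

lemma decode_mem {R : Finset (I → ℤ)} (hR : D.IsRoots R) {e : Fin N ≃ I}
    (he : ∀ a b : Fin N, D.A (e a) (e b) = M a b) {v : ℕ} (hv : v ∈ T) : decode e v ∈ R := by
  induction v using Nat.strong_induction_on with
  | _ v ih =>
    obtain ⟨j, hj, h⟩ := hT.descent v hv
    lift j to Fin N using hj
    by_cases hs : v = 10 ^ (j : ℕ)
    · rw [hs, hT.decode_simple]
      exact hR.single_mem _
    have hlt := h.resolve_left hs
    rcases hT.decode_reflect he hv j with h0 | h0 | ⟨hm, h1⟩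
    · rw [pair_decode he] at h0
      simp [codeReflect, h0] at hlt
    · exact (hs h0).elim
    · have := hR.reflect_mem _ (ih _ hlt hm) (e j)
      rw [h1, map_sub, map_smul, pair_single, D.A_self] at this
      convert this using 1
      rw [smul_eq_mul]
      module

lemma mem_or_neg_mem {R : Finset (I → ℤ)} (hR : D.IsRoots R) {e : Fin N ≃ I}
    (he : ∀ a b : Fin N, D.A (e a) (e b) = M a b) :
    ∀ x ∈ R, ∃ v ∈ T, x = decode e v ∨ x = -decode e v := by
  have key {v : ℕ} (hv : v ∈ T) (j : I) : ∃ w ∈ T,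
      decode e v - D.pair j (decode e v) • Pi.single j 1 = decode e w ∨
      decode e v - D.pair j (decode e v) • Pi.single j 1 = -decode e w := by
    obtain ⟨j, rfl⟩ := e.surjective j
    rcases hT.decode_reflect he hv j with h | rfl | ⟨h, h'⟩
    · exact ⟨v, hv, Or.inl (by simp [h])⟩
    · refine ⟨_, hv, Or.inr ?_⟩
      rw [hT.decode_simple, pair_single, D.A_self]
      module
    · exact ⟨_, h, Or.inl h'.symm⟩
  refine hR.induction _ (fun i ↦ ?_) (fun x hx ↦ ?_) (fun x j hx ↦ ?_)
  · refine ⟨10 ^ (e.symm i : ℕ), (hT.simple _ (e.symm i).2).1, Or.inl ?_⟩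
    rw [hT.decode_simple, Equiv.apply_symm_apply]
  · obtain ⟨v, hv, rfl | rfl⟩ := hx
    · exact ⟨v, hv, Or.inr rfl⟩
    · exact ⟨v, hv, Or.inl (neg_neg _)⟩
  · obtain ⟨v, hv, rfl | rfl⟩ := hx
    · exact key hv j
    · obtain ⟨w, hw, h⟩ := key hv j
      refine ⟨w, hw, h.symm.imp (fun h ↦ ?_) (fun h ↦ ?_)⟩ <;>
      · rw [map_neg, ← neg_inj, ← h]
        module

lemma manyLargeRoots {R : Finset (I → ℤ)} (hR : D.IsRoots R) (h : D.HasMatrix N M)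
    (g : ℕ → ℤ) (B : ℤ) (hB : ∀ v ∈ T, |codeEval N g v| ≤ B)
    (hcard : 2 * T.length + N ≤ 7 * (T.filter fun v ↦ B < 2 * codeEval N g v).length) :
    ManyLargeRoots R := by
  obtain ⟨e, he⟩ := h
  have hg (v : ℕ) : (∑ i, g (e.symm i) • LinearMap.proj i : (I → ℤ) →ₗ[ℤ] ℤ) (decode e v) =
      codeEval N g v := by
    simp [LinearMap.sum_apply, ← sum_mul_decode e]
  have hI : Fintype.card I = N := by simp [← Fintype.card_congr e]
  refine ⟨∑ i, g (e.symm i) • LinearMap.proj i, B, fun x hx ↦ ?_, ?_⟩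
  · obtain ⟨v, hv, rfl | rfl⟩ := hT.mem_or_neg_mem hR he x hx
    · rw [hg]
      exact (abs_le.mp (hB v hv)).2
    · rw [map_neg, hg]
      linarith [(abs_le.mp (hB v hv)).1]
  have h1 : R ⊆ T.toFinset.image (decode e) ∪ T.toFinset.image (-decode e ·) := by
    intro x hx
    obtain ⟨v, hv, rfl | rfl⟩ := hT.mem_or_neg_mem hR he x hx
    · exact Finset.mem_union_left _ (Finset.mem_image_of_mem _ (by simpa))
    · exact Finset.mem_union_right _ (Finset.mem_image_of_mem _ (by simpa))
  have h2 : R.card ≤ T.length + T.length := (Finset.card_le_card h1).trans <|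
    (Finset.card_union_le _ _).trans <| add_le_add
      (Finset.card_image_le.trans T.toFinset_card_le)
      (Finset.card_image_le.trans T.toFinset_card_le)
  have h3 : (T.filter fun v ↦ B < 2 * codeEval N g v).length ≤
      (R.filter fun x ↦ B < 2 * (∑ i, g (e.symm i) • LinearMap.proj i :
        (I → ℤ) →ₗ[ℤ] ℤ) x).card := by
    rw [← List.toFinset_card_of_nodup (hT.nodup.filter _),
      ← Finset.card_image_of_injOn ((hT.decode_injOn e).mono _)]
    · refine Finset.card_le_card fun x hx ↦ ?_
      obtain ⟨v, hv, rfl⟩ := Finset.mem_image.mp hx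
      simp only [List.mem_toFinset, List.mem_filter, decide_eq_true_eq] at hv
      rw [Finset.mem_filter, hg]
      exact ⟨hT.decode_mem hR he hv.1, hv.2⟩
    · intro v hv
      simp only [List.coe_toFinset, List.mem_filter] at hv
      exact hv.1
  omega

end IsTable

/-- Every finite irreducible root system has sufficiently many large roots. -/
theorem IsRoots.manyLargeRoots [Nonempty I] {R : Finset (I → ℤ)} (hR : D.IsRoots R) :
    ManyLargeRoots R := by
  cases D.classified with
  | typeA c m hm hc h => exact manyLargeRoots_A hR hm hc h
  | typeB c m v hm hc hv h =>
    exact manyLargeRoots_BC hR h hc (Or.inl ⟨rfl, rfl, hm⟩) hv (hv.ne (by norm_num))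
  | typeC c m v hm hc hv h =>
    exact manyLargeRoots_BC hR h hc (Or.inr ⟨rfl, rfl, hm⟩) hv (hv.ne (by norm_num))
  | typeD c m v hm hc hv h => exact manyLargeRoots_D hR h hc hm hv (hv.ne (by norm_num))
  | typeE₆ h =>
    exact isTable_E₆.manyLargeRoots hR h (if · = 4 then 1 else 0) 1 (by decide +kernel)
      (by decide +kernel)
  | typeE₇ h =>
    exact isTable_E₇.manyLargeRoots hR h (if · = 5 then 1 else 0) 1 (by decide +kernel)
      (by decide +kernel)
  | typeE₈ h =>
    exact isTable_E₈.manyLargeRoots hR h (if · = 7 then 1 else 0) 3 (by decide +kernel)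
      (by decide +kernel)
  | typeF₄ h =>
    exact isTable_F₄.manyLargeRoots hR h (if · ∈ [1, 3] then 1 else 0) 5 (by decide +kernel)
      (by decide +kernel)
  | typeG₂ h =>
    exact isTable_G₂.manyLargeRoots hR h (if · = 0 then 1 else 0) 3 (by decide +kernel)
      (by decide +kernel)

end

end FiniteCartan

namespace RootPairing.Base

variable {ι K V W : Type*} [Field K] [CharZero K] [AddCommGroup V] [Module K V]
  [AddCommGroup W] [Module K W] {P : RootPairing ι K V W} (b : P.Base)
  [Fintype ι] [DecidableEq ι] [P.IsCrystallographic] [P.IsRootSystem]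

/-- The abstract Cartan matrix of an irreducible root system. -/
noncomputable def finiteCartan [P.IsReduced] [P.IsIrreducible] : FiniteCartan b.support where
  A := b.cartanMatrix
  d := b.exists_cartanMatrix_mul_diagaonal_posDef.choose
  A_self := b.cartanMatrix_apply_same
  A_nonpos := b.cartanMatrix_le_zero_of_ne
  d_pos := b.exists_cartanMatrix_mul_diagaonal_posDef.choose_spec.1
  symm i j := by
    have := b.exists_cartanMatrix_mul_diagaonal_posDef.choose_spec.2.isHermitian.apply j i
    rwa [Matrix.mul_diagonal, Matrix.mul_diagonal, star_trivial] at this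
  posDef x hx := by
    have := (Matrix.posDef_iff_dotProduct_mulVec.mp
      b.exists_cartanMatrix_mul_diagaonal_posDef.choose_spec.2).2 hx
    simp only [dotProduct, Matrix.mulVec, Finset.mul_sum, Matrix.mul_diagonal, star_trivial] at this
    refine this.trans_eq (Finset.sum_congr rfl fun i _ ↦ Finset.sum_congr rfl fun j _ ↦ ?_)
    ring
  connected p _ _ hi hp := b.induction_on_cartanMatrix p hi hp

/-- The vector with given simple root coordinates. -/
def ofCoords : (b.support → ℤ) →ₗ[ℤ] V := Fintype.linearCombination ℤ fun i ↦ P.root i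

omit [CharZero K] [Fintype ι] [P.IsCrystallographic] [P.IsRootSystem] in
@[simp] lemma ofCoords_single (i : b.support) : b.ofCoords (Pi.single i 1) = P.root i := by
  simp [ofCoords, Fintype.linearCombination_apply_single]

omit [Fintype ι] [DecidableEq ι] [P.IsCrystallographic] [P.IsRootSystem] in
lemma ofCoords_injective : Function.Injective b.ofCoords := by
  have h := b.linearIndepOn_root.linearIndependent.restrict_scalars (R := ℤ)
    (by simpa using Int.cast_injective)
  exact LinearIndependent.fintypeLinearCombination_injective h

omit [Fintype ι] [DecidableEq ι] [P.IsCrystallographic] [P.IsRootSystem] in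
lemma exists_ofCoords (i : ι) : ∃ x, b.ofCoords x = P.root i := by
  obtain ⟨f, -, -, h⟩ := b.exists_root_eq_sum_int i
  refine ⟨fun j ↦ f j, ?_⟩
  rw [h, ofCoords, Fintype.linearCombination_apply]
  exact Finset.sum_coe_sort b.support fun j ↦ f j • P.root j

/-- The simple root coordinates of a root. -/
noncomputable def coords (i : ι) : b.support → ℤ := (b.exists_ofCoords i).choose

omit [Fintype ι] [DecidableEq ι] [P.IsCrystallographic] [P.IsRootSystem] in
@[simp] lemma ofCoords_coords (i : ι) : b.ofCoords (b.coords i) = P.root i :=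
  (b.exists_ofCoords i).choose_spec

omit [Fintype ι] [P.IsCrystallographic] [P.IsRootSystem] in
lemma coords_self (i : b.support) : b.coords i = Pi.single i 1 :=
  b.ofCoords_injective (by simp)

omit [Fintype ι] [DecidableEq ι] [P.IsCrystallographic] [P.IsRootSystem] in
lemma coords_injective : Function.Injective b.coords := fun i j h ↦ by
  rw [← P.root.injective.eq_iff, ← b.ofCoords_coords, h, b.ofCoords_coords]

variable [P.IsReduced] [P.IsIrreducible]

lemma coroot_ofCoords (j : b.support) (x : b.support → ℤ) :
    P.coroot' j (b.ofCoords x) = (b.finiteCartan.pair j x : K) := by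
  rw [FiniteCartan.pair_apply, ofCoords, Fintype.linearCombination_apply, map_sum, Int.cast_sum]
  refine Finset.sum_congr rfl fun i _ ↦ ?_
  rw [map_zsmul, root_coroot'_eq_pairing, ← P.algebraMap_pairingIn ℤ, Int.cast_mul, mul_comm,
    zsmul_eq_mul]
  rfl

lemma ofCoords_reflect (j : b.support) (x : b.support → ℤ) :
    b.ofCoords (x - b.finiteCartan.pair j x • Pi.single j 1) = P.reflection j (b.ofCoords x) := by
  rw [map_sub, map_smul, ofCoords_single, reflection_apply, coroot_ofCoords, Int.cast_smul_eq_zsmul]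

lemma coords_reflectionPerm (i : ι) (j : b.support) : b.coords (P.reflectionPerm j i) =
    b.coords i - b.finiteCartan.pair j (b.coords i) • Pi.single j 1 :=
  b.ofCoords_injective (by rw [ofCoords_reflect]; simp [root_reflectionPerm])

omit [Fintype ι] [DecidableEq ι] [P.IsCrystallographic] [P.IsRootSystem] [P.IsReduced]
  [P.IsIrreducible] in
lemma coords_reflectionPerm_self (i : ι) : b.coords (P.reflectionPerm i i) = -b.coords i :=
  b.ofCoords_injective (by simp [root_reflectionPerm])

lemma isRoots_image_coords : b.finiteCartan.IsRoots (Finset.univ.image b.coords) where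
  single_mem i := Finset.mem_image.mpr ⟨i, Finset.mem_univ _, b.coords_self i⟩
  neg_mem x hx := by
    obtain ⟨i, -, rfl⟩ := Finset.mem_image.mp hx
    exact Finset.mem_image.mpr ⟨_, Finset.mem_univ _, b.coords_reflectionPerm_self i⟩
  reflect_mem x hx j := by
    obtain ⟨i, -, rfl⟩ := Finset.mem_image.mp hx
    exact Finset.mem_image.mpr ⟨_, Finset.mem_univ _, b.coords_reflectionPerm i j⟩
  induction p h1 h2 h3 x hx := by
    obtain ⟨i, -, rfl⟩ := Finset.mem_image.mp hx
    refine b.induction_reflect i (p := fun i ↦ p (b.coords i)) (fun i hi ↦ ?_) (fun i hi ↦ ?_)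
      (fun i j hi hj ↦ ?_)
    · rw [coords_reflectionPerm_self]
      exact h2 _ hi
    · exact b.coords_self ⟨i, hi⟩ ▸ h1 ⟨i, hi⟩
    · rw [b.coords_reflectionPerm i ⟨j, hj⟩]
      exact h3 _ _ hi

end RootPairing.Base

/-- In an irreducible root system, there are many roots on which some linear functional takes more
than half of its maximal value. -/
theorem RootPairing.exists_many_large_roots {ι K V W : Type*} [Field K] [CharZero K]
    [AddCommGroup V] [Module K V] [AddCommGroup W] [Module K W] (P : RootPairing ι K V W)
    [Fintype ι] [P.IsCrystallographic] [P.IsRootSystem] [P.IsReduced] [P.IsIrreducible] :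
    ∃ (f : ι → ℤ) (m : ℤ), (∀ i, f i ≤ m) ∧
      (∀ i j k, P.root i + P.root j = P.root k → f i + f j = f k) ∧
      (∀ i j, P.root i + P.root j = 0 → f i + f j = 0) ∧
      Fintype.card ι + Module.finrank K V ≤ 7 * (Finset.univ.filter fun i ↦ m < 2 * f i).card := by
  classical
  obtain ⟨b⟩ := P.nonempty_base
  have hV := Module.finrank_eq_card_basis b.toWeightBasis
  have : Nontrivial V := IsIrreducible.nontrivial P
  have : Nonempty b.support := by
    rw [← Fintype.card_pos_iff, ← hV]
    have := b.toWeightBasis.finiteDimensional_of_finite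
    exact Module.finrank_pos
  obtain ⟨f, m, hm, hcard⟩ := b.isRoots_image_coords.manyLargeRoots
  refine ⟨fun i ↦ f (b.coords i), m,
    fun i ↦ hm _ (Finset.mem_image_of_mem _ (Finset.mem_univ i)), fun i j k h ↦ ?_, fun i j h ↦ ?_,
    ?_⟩
  · rw [← map_add]
    congr 1
    exact b.ofCoords_injective (by simpa using h)
  · rw [← map_add, show b.coords i + b.coords j = 0 from b.ofCoords_injective (by simpa using h),
      map_zero]
  · rw [hV]
    rwa [Finset.filter_image, Finset.card_image_of_injective _ b.coords_injective,
      Finset.card_image_of_injective _ b.coords_injective, Finset.card_univ] at hcard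

namespace LieAlgebra.IsKilling

open LieModule

variable {K L : Type*} [Field K] [CharZero K] [LieRing L] [LieAlgebra K L] [FiniteDimensional K L]
  [IsKilling K L] (H : LieSubalgebra K L) [H.IsCartanSubalgebra] [IsTriangularizable K H L]

lemma exists_linearIndependent_rootVectors : ∃ v : H.root → L, LinearIndependent K v ∧
    ∀ α : H.root, (rootSpace H (α : Weight K H L)).toSubmodule = K ∙ v α := by
  have h (α : H.root) : ∃ v : L, v ≠ 0 ∧
      (rootSpace H (α : Weight K H L)).toSubmodule = K ∙ v := by
    obtain ⟨v, hv, h⟩ := finrank_eq_one_iff'.mp <|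
      finrank_rootSpace_eq_one (α : Weight K H L) (Finset.mem_filter.mp α.2).2
    refine ⟨v, by simpa using hv, le_antisymm (fun w hw ↦ ?_) ?_⟩
    · obtain ⟨c, hc⟩ := h ⟨w, hw⟩
      exact Submodule.mem_span_singleton.mpr ⟨c, congrArg Subtype.val hc⟩
    · rw [Submodule.span_singleton_le_iff_mem]
      exact v.2
  choose v hv0 hv using h
  refine ⟨v, ?_, hv⟩
  have hind := (LieSubmodule.iSupIndep_toSubmodule.mpr (iSupIndep_genWeightSpace' K H L)).comp
    (Subtype.val_injective (p := (· ∈ H.root)))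
  exact hind.linearIndependent _ (fun α ↦ (hv α).ge (Submodule.mem_span_singleton_self _)) hv0

lemma finrank_le_card_root_add : Module.finrank K L ≤ H.root.card + Module.finrank K H := by
  obtain ⟨v, -, hv⟩ := exists_linearIndependent_rootVectors H
  have htop : Submodule.span K (Set.range v) ⊔ H.toSubmodule = ⊤ := by
    rw [eq_top_iff, ← LieSubmodule.top_toSubmodule (R := K) (L := H) (M := L),
      ← iSup_genWeightSpace_eq_top' K H L,
      LieSubmodule.iSup_toSubmodule]
    refine iSup_le fun α ↦ ?_
    by_cases hα : α.IsZero
    · refine le_sup_of_le_right ?_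
      rw [hα]
      exact (congrArg _ (rootSpace_zero_eq K L H)).le
    · refine le_sup_of_le_left ?_
      have := hv ⟨α, by simpa using hα⟩
      rw [this, Submodule.span_singleton_le_iff_mem]
      exact Submodule.subset_span ⟨_, rfl⟩
  rw [← finrank_top, ← htop]
  refine (Submodule.finrank_add_le_finrank_add_finrank _ _).trans (Nat.add_le_add_right ?_ _)
  exact (finrank_range_le_card (R := K) v).trans (Fintype.card_coe _).le

omit [IsKilling K L] [IsTriangularizable K H L] in
lemma lie_eq_zero_of_mem_rootSpace {χ₁ χ₂ : Module.Dual K H} (h0 : χ₁ + χ₂ ≠ 0)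
    (h : ∀ α ∈ H.root, χ₁ + χ₂ ≠ Weight.toLinear K H L α) {x y : L}
    (hx : x ∈ rootSpace H χ₁) (hy : y ∈ rootSpace H χ₂) : ⁅x, y⁆ = 0 := by
  have hxy := lie_mem_genWeightSpace_of_mem_genWeightSpace hx hy
  by_contra hne
  let α : Weight K H L := ⟨χ₁ + χ₂, fun hbot ↦ hne (by simpa [hbot] using hxy)⟩
  have hα : χ₁ + χ₂ = Weight.toLinear K H L α := rfl
  refine h α ?_ hα
  refine Finset.mem_filter.mpr ⟨Finset.mem_univ _, fun hz ↦ h0 (hα.trans ?_)⟩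
  exact LinearMap.ext fun t ↦ congrFun hz t

lemma exists_abelian_finrank_eq_card (S : Finset H.root)
    (h0 : ∀ α ∈ S, ∀ β ∈ S, (rootSystem H).root α + (rootSystem H).root β ≠ 0)
    (h : ∀ α ∈ S, ∀ β ∈ S, ∀ γ,
      (rootSystem H).root α + (rootSystem H).root β ≠ (rootSystem H).root γ) :
    ∃ A : LieSubalgebra K L, IsLieAbelian A ∧ Module.finrank K A = S.card := by
  obtain ⟨v, hv, hvs⟩ := exists_linearIndependent_rootVectors H
  have hmem (α : H.root) : v α ∈ rootSpace H (α : Weight K H L) :=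
    (hvs α).ge (Submodule.mem_span_singleton_self _)
  have hlie : ∀ x ∈ Submodule.span K (Set.range fun α : S ↦ v α),
      ∀ y ∈ Submodule.span K (Set.range fun α : S ↦ v α), ⁅x, y⁆ = 0 := by
    intro x hx y hy
    induction hx, hy using Submodule.span_induction₂ with
    | mem_mem x y hx hy =>
      obtain ⟨α, rfl⟩ := hx
      obtain ⟨β, rfl⟩ := hy
      exact lie_eq_zero_of_mem_rootSpace H (h0 α α.2 β β.2)
        (fun γ hγ ↦ h α α.2 β β.2 ⟨γ, hγ⟩) (hmem α) (hmem β)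
    | zero_left y hy => exact zero_lie y
    | zero_right x hx => exact lie_zero x
    | add_left x y z _ _ _ h1 h2 => rw [add_lie, h1, h2, add_zero]
    | add_right x y z _ _ _ h1 h2 => rw [lie_add, h1, h2, add_zero]
    | smul_left r x y _ _ h1 => rw [smul_lie, h1, smul_zero]
    | smul_right r x y _ _ h1 => rw [lie_smul, h1, smul_zero]
  refine ⟨{ Submodule.span K (Set.range fun α : S ↦ v α) with
    lie_mem' := fun {x y} hx hy ↦ ?_ }, ⟨fun x y ↦ Subtype.ext (hlie x x.2 y y.2)⟩, ?_⟩
  · exact (hlie x hx y hy).symm ▸ Submodule.zero_mem _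
  · exact (finrank_span_eq_card (hv.comp _ Subtype.val_injective)).trans (Fintype.card_coe S)

end LieAlgebra.IsKilling

open LieAlgebra LieAlgebra.IsKilling in
/-- If `𝔤` is a finite-dimensional simple complex Lie algebra in which every abelian Lie
subalgebra has dimension at most `n`, then `dim 𝔤 ≤ 7n`. -/
theorem dim_le_of_simple_complex_lie_algebra
    (L : Type*) [LieRing L] [LieAlgebra ℂ L]
    [FiniteDimensional ℂ L] [LieAlgebra.IsSimple ℂ L] (n : ℕ)
    (hA : ∀ H : LieSubalgebra ℂ L, IsLieAbelian H → Module.finrank ℂ H ≤ n) :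
    Module.finrank ℂ L ≤ 7 * n := by
  obtain ⟨x, hx⟩ := exists_isCartanSubalgebra_engel ℂ L
  set H := LieSubalgebra.engel ℂ x
  have := HasTrivialRadical.instIsKilling ℂ L
  obtain ⟨f, m, hm, hf, hf0, hcard⟩ := (rootSystem H).exists_many_large_roots
  obtain ⟨A, hAb, hAS⟩ := exists_abelian_finrank_eq_card H
    (Finset.univ.filter fun i ↦ m < 2 * f i)
    (fun α hα β hβ h ↦ by
      rw [Finset.mem_filter] at hα hβ
      have := hf0 α β h
      have := hm α
      have := hm β
      omega)
    (fun α hα β hβ γ h ↦ by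
      rw [Finset.mem_filter] at hα hβ
      have := hf α β γ h
      have := hm γ
      omega)
  have h1 := hA A hAb
  have h2 := finrank_le_card_root_add H
  rw [Subspace.dual_finrank_eq, Fintype.card_coe] at hcard
  omega
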